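/- Let f ∈ ℬ with upper and lower semicontinuous envelopes f*(x) = limsup_{y→x} f(y) and f_*(x) = liminf_{y→x} f(y). Then with probability one the following holds simultaneously for all x, v ∈ (0,∞)^d: limsup_{n→∞} n^{-1/d} ℓ(𝒫_{nf} ∩ S_{x,v}) ≤ (c_d/d) · (sup_{S_{x,v}} f* / (v_1 ⋯ v_d))^{1/d}, and liminf_{n→∞} n^{-1/d} ℓ(𝒫_{nf} ∩ S_{x,v}) ≥ (c_d/d) · (inf_{S_{x,v}} f_* / (v_1 ⋯ v_d))^{1/d}. -/

import Mathlib

open MeasureTheory Filter Set Topology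

noncomputable section

/-- `ℓ(A)`: the maximal cardinality of a chain (finite subset totally ordered by the
coordinatewise partial order `≤`) contained in `A ⊆ ℝ^d`. -/
def chainLength (d : ℕ) (A : Set (Fin d → ℝ)) : ℕ :=
  sSup {n : ℕ | ∃ C : Finset (Fin d → ℝ),
    ↑C ⊆ A ∧ IsChain (· ≤ ·) (C : Set (Fin d → ℝ)) ∧ C.card = n}

/-- The class `ℬ` of nonnegative, locally bounded, Lebesgue-measurable functions. -/
def MemB (d : ℕ) (f : (Fin d → ℝ) → ℝ) : Prop :=
  Measurable f ∧ (∀ x, 0 ≤ f x) ∧ ∀ x : Fin d → ℝ, ∃ U ∈ 𝓝 x, BddAbove (f '' U)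

/-- The Euclidean norm on `ℝ^d` (modelled as `Fin d → ℝ`). -/
def euclNorm (d : ℕ) (x : Fin d → ℝ) : ℝ := Real.sqrt (∑ i, (x i) ^ 2)

/-- The expectation `E[ℓ_n]` of the length of a longest chain among `n` i.i.d. points
uniformly distributed in the unit cube `[0,1]^d`. -/
def BWexpect (d n : ℕ) : ℝ :=
  ∫ X : Fin n → Fin d → ℝ, (chainLength d (Set.range X) : ℝ)
    ∂(Measure.pi fun _ => volume.restrict (Set.Icc (0 : Fin d → ℝ) 1))

/-- `c` is the Bollobás–Winkler constant `c_d`: `c > 0` and `n^{-1/d} E[ℓ_n] → c`. -/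
def IsBWConstant (d : ℕ) (c : ℝ) : Prop :=
  0 < c ∧ Tendsto (fun n : ℕ => (n : ℝ) ^ (-(1 : ℝ) / d) * BWexpect d n) atTop (nhds c)

/-- A Poisson point process on `ℝ^d` with intensity function `g`, on a probability space
`(Ω, P)`: a random at-most-countable subset of `ℝ^d` such that for every bounded Borel set `A`
the count `#(pts ω ∩ A)` is measurable with Poisson distribution of mean `∫_A g`, and counts of
pairwise disjoint Borel sets are independent. -/
structure PoissonPP (d : ℕ) {Ω : Type*} [MeasurableSpace Ω] (P : Measure Ω)
    (g : (Fin d → ℝ) → ℝ) where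
  pts : Ω → Set (Fin d → ℝ)
  countable : ∀ ω, (pts ω).Countable
  measur : ∀ A : Set (Fin d → ℝ), MeasurableSet A → Bornology.IsBounded A →
    ∀ k : ℕ, MeasurableSet {ω | (pts ω ∩ A).encard = k}
  poisson : ∀ A : Set (Fin d → ℝ), MeasurableSet A → Bornology.IsBounded A →
    ∀ k : ℕ, P {ω | (pts ω ∩ A).encard = k}
      = ENNReal.ofReal (Real.exp (-(∫ x in A, g x)) * (∫ x in A, g x) ^ k / k.factorial)
  indep : ∀ (n : ℕ) (A : Fin n → Set (Fin d → ℝ)),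
    (∀ i, MeasurableSet (A i)) → (∀ i, Bornology.IsBounded (A i)) →
    (Pairwise fun i j => Disjoint (A i) (A j)) →
    ∀ k : Fin n → ℕ,
      P (⋂ i, {ω | (pts ω ∩ A i).encard = k i})
        = ∏ i, P {ω | (pts ω ∩ A i).encard = k i}

/-- Upper semicontinuous envelope `f*`. -/
def upperEnv (d : ℕ) (f : (Fin d → ℝ) → ℝ) (x : Fin d → ℝ) : ℝ := limsup f (𝓝 x)

/-- Lower semicontinuous envelope `f_*`. -/
def lowerEnv (d : ℕ) (f : (Fin d → ℝ) → ℝ) (x : Fin d → ℝ) : ℝ := liminf f (𝓝 x)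

/-- The simplex `S_{x,v} = {z : z ≤ x, ⟨x-z,v⟩ ≤ 1}`. -/
def simplexS (d : ℕ) (x v : Fin d → ℝ) : Set (Fin d → ℝ) :=
  {z | z ≤ x ∧ ∑ i, (x i - z i) * v i ≤ 1}

/-- `u` is a nondecreasing viscosity solution of the problem (P):
`u_{x_1} ⋯ u_{x_d} = (c_d/d)^d f` in `(0,∞)^d`, `u = 0` on `∂ℝ^d_+`. -/
def IsNDViscSol (d : ℕ) (c : ℝ) (f u : (Fin d → ℝ) → ℝ) : Prop :=
  ContinuousOn u (Set.Ici 0) ∧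
  (∀ x y : Fin d → ℝ, 0 ≤ x → x ≤ y → u x ≤ u y) ∧
  (∀ x : Fin d → ℝ, 0 ≤ x → (∃ i, x i = 0) → u x = 0) ∧
  (∀ x₀ : Fin d → ℝ, (∀ i, 0 < x₀ i) →
    ∀ φ : (Fin d → ℝ) → ℝ, ContDiff ℝ ((⊤ : ℕ∞) : WithTop ℕ∞) φ →
      IsLocalMaxOn (fun y => u y - φ y) (Set.Ici 0) x₀ →
      ∏ i, fderiv ℝ φ x₀ (Pi.single i 1) ≤ (c / d) ^ d * upperEnv d f x₀) ∧
  (∀ x₀ : Fin d → ℝ, (∀ i, 0 < x₀ i) →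
    ∀ φ : (Fin d → ℝ) → ℝ, ContDiff ℝ ((⊤ : ℕ∞) : WithTop ℕ∞) φ →
      IsLocalMinOn (fun y => u y - φ y) (Set.Ici 0) x₀ →
      (c / d) ^ d * lowerEnv d f x₀ ≤ ∏ i, fderiv ℝ φ x₀ (Pi.single i 1))

/-- The expectation of `F` evaluated at a random subset of `T` which contains each `k ∈ T`
independently with probability `p k`. -/
def bernoulliExp {K : Type*} [DecidableEq K] (p : K → ℝ) (T : Finset K)
    (F : Finset K → ℝ) : ℝ :=
  ∑ S ∈ T.powerset, ((∏ k ∈ S, p k) * ∏ k ∈ T \ S, (1 - p k)) * F S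

section bernoulliExp

variable {K : Type*} [DecidableEq K] {p : K → ℝ} {T : Finset K}

lemma bernoulliExp_empty (p : K → ℝ) (F : Finset K → ℝ) : bernoulliExp p ∅ F = F ∅ := by
  simp [bernoulliExp]

lemma bernoulliExp_insert (p : K → ℝ) {a : K} (ha : a ∉ T) (F : Finset K → ℝ) :
    bernoulliExp p (insert a T) F =
      p a * bernoulliExp p T (fun S => F (insert a S)) + (1 - p a) * bernoulliExp p T F := by
  unfold bernoulliExp
  rw [Finset.sum_powerset_insert ha, add_comm, Finset.mul_sum, Finset.mul_sum]
  congr 1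
  · refine Finset.sum_congr rfl fun S hS => ?_
    have hST := Finset.mem_powerset.1 hS
    have haS : a ∉ S := fun h => ha (hST h)
    rw [Finset.prod_insert haS, Finset.insert_sdiff_insert, Finset.sdiff_insert_of_notMem ha]
    ring
  · refine Finset.sum_congr rfl fun S hS => ?_
    have hST := Finset.mem_powerset.1 hS
    have haS : a ∉ S := fun h => ha (hST h)
    rw [Finset.insert_sdiff_of_notMem _ haS, Finset.prod_insert (by simp [ha])]
    ring

lemma bernoulliExp_add (F G : Finset K → ℝ) :
    bernoulliExp p T (fun S => F S + G S) = bernoulliExp p T F + bernoulliExp p T G := by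
  simp [bernoulliExp, mul_add, Finset.sum_add_distrib]

lemma bernoulliExp_const_mul (r : ℝ) (F : Finset K → ℝ) :
    bernoulliExp p T (fun S => r * F S) = r * bernoulliExp p T F := by
  simp only [bernoulliExp, Finset.mul_sum]
  exact Finset.sum_congr rfl fun S _ => by ring

lemma bernoulliExp_congr {F G : Finset K → ℝ} (h : ∀ S ⊆ T, F S = G S) :
    bernoulliExp p T F = bernoulliExp p T G :=
  Finset.sum_congr rfl fun S hS => by rw [h S (Finset.mem_powerset.1 hS)]

lemma bernoulliExp_mono (hp : ∀ k, p k ∈ Icc (0 : ℝ) 1) {F G : Finset K → ℝ}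
    (h : ∀ S ⊆ T, F S ≤ G S) : bernoulliExp p T F ≤ bernoulliExp p T G := by
  refine Finset.sum_le_sum fun S hS => mul_le_mul_of_nonneg_left (h S (Finset.mem_powerset.1 hS)) ?_
  exact mul_nonneg (Finset.prod_nonneg fun k _ => (hp k).1)
    (Finset.prod_nonneg fun k _ => sub_nonneg.2 (hp k).2)

lemma bernoulliExp_const (p : K → ℝ) (T : Finset K) (r : ℝ) :
    bernoulliExp p T (fun _ => r) = r := by
  induction T using Finset.induction_on with
  | empty => exact bernoulliExp_empty _ _
  | insert a T ha ih => rw [bernoulliExp_insert p ha, ih]; ring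

lemma bernoulliExp_pos (hp : ∀ k, p k ∈ Icc (0 : ℝ) 1) {F : Finset K → ℝ}
    (hF : ∀ S, 0 < F S) : 0 < bernoulliExp p T F := by
  induction T using Finset.induction_on generalizing F with
  | empty => rw [bernoulliExp_empty]; exact hF _
  | insert a T ha ih =>
    rw [bernoulliExp_insert p ha]
    have h1 := ih (F := fun S => F (insert a S)) fun S => hF _
    have h2 := ih hF
    rcases (hp a).1.eq_or_lt with h0 | h0
    · rw [← h0]; simpa using h2
    · exact add_pos_of_pos_of_nonneg (mul_pos h0 h1)
        (mul_nonneg (sub_nonneg.2 (hp a).2) h2.le)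

/-- The expectation of a monotone function increases with the inclusion probabilities. -/
lemma bernoulliExp_mono_prob {q : K → ℝ} (hp : ∀ k, p k ∈ Icc (0 : ℝ) 1)
    (hq : ∀ k, q k ∈ Icc (0 : ℝ) 1) (hpq : ∀ k, p k ≤ q k) {F : Finset K → ℝ}
    (hF : Monotone F) : bernoulliExp p T F ≤ bernoulliExp q T F := by
  induction T using Finset.induction_on generalizing F with
  | empty => simp [bernoulliExp_empty]
  | insert a T ha ih =>
    rw [bernoulliExp_insert p ha, bernoulliExp_insert q ha]
    have h1 := ih (F := fun S => F (insert a S)) fun S S' h => hF (Finset.insert_subset_insert a h)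
    have h2 := ih hF
    have h3 : bernoulliExp q T F ≤ bernoulliExp q T (fun S => F (insert a S)) :=
      bernoulliExp_mono hq fun S _ => hF (Finset.subset_insert a S)
    nlinarith [mul_le_mul_of_nonneg_left h1 (hp a).1,
      mul_le_mul_of_nonneg_left h2 (sub_nonneg.2 (hp a).2),
      mul_le_mul_of_nonneg_left h3 (sub_nonneg.2 (hpq a))]

/-- The log-sum inequality. -/
lemma logSum_le_bernoulliExp (hp : ∀ k, p k ∈ Icc (0 : ℝ) 1) {F G : Finset K → ℝ}
    (hF : ∀ S, 0 < F S) (hG : ∀ S, 0 < G S) :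
    bernoulliExp p T F * Real.log (bernoulliExp p T F / bernoulliExp p T G) ≤
      bernoulliExp p T (fun S => F S * Real.log (F S / G S)) := by
  have hX := bernoulliExp_pos (T := T) hp hF
  have hY := bernoulliExp_pos (T := T) hp hG
  set X := bernoulliExp p T F with hXdef
  set Y := bernoulliExp p T G with hYdef
  have key : ∀ S ⊆ T, Real.log (X / Y) * F S + (1 * F S + (-(X / Y)) * G S) ≤
      F S * Real.log (F S / G S) := by
    intro S _
    have hr : 0 < X / Y := div_pos hX hY
    have hFS := hF S
    have hGS := hG S
    have h1 := Real.log_le_sub_one_of_pos (div_pos (mul_pos hGS hr) hFS)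
    rw [Real.log_div (mul_pos hGS hr).ne' hFS.ne', Real.log_mul hGS.ne' hr.ne'] at h1
    rw [Real.log_div hFS.ne' hGS.ne']
    have h2 := mul_le_mul_of_nonneg_left h1 hFS.le
    have h3 : F S * (G S * (X / Y) / F S - 1) = G S * (X / Y) - F S := by field_simp
    rw [h3] at h2
    nlinarith
  have h := bernoulliExp_mono hp key
  rw [bernoulliExp_add, bernoulliExp_add, bernoulliExp_const_mul, bernoulliExp_const_mul,
    bernoulliExp_const_mul, ← hXdef, ← hYdef] at h
  have h4 : -(X / Y) * Y = -X := by field_simp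
  rw [h4] at h
  linarith

/-- The contribution of the coordinate `k` to the entropy bound for `F`. -/
def entropyTerm (F : Finset K → ℝ) (k : K) (S : Finset K) : ℝ :=
  if k ∈ S then F S * Real.log (F S / F (S.erase k)) - F S + F (S.erase k) else 0

/-- Tensorization of entropy for independent Bernoulli variables. -/
lemma entropy_le_bernoulliExp (hp : ∀ k, p k ∈ Icc (0 : ℝ) 1) {F : Finset K → ℝ}
    (hF : ∀ S, 0 < F S) :
    bernoulliExp p T (fun S => F S * Real.log (F S)) -
        bernoulliExp p T F * Real.log (bernoulliExp p T F) ≤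
      bernoulliExp p T (fun S => ∑ k ∈ T, entropyTerm F k S) := by
  induction T using Finset.induction_on generalizing F with
  | empty => simp [bernoulliExp_empty]
  | insert a T ha ih =>
    have ih1 := ih (F := fun S => F (insert a S)) fun S => hF _
    have ih0 := ih hF
    have hls := logSum_le_bernoulliExp (T := T) hp (F := fun S => F (insert a S)) (G := F)
      (fun S => hF _) hF
    have hA := bernoulliExp_pos (T := T) hp (F := fun S => F (insert a S)) fun S => hF _
    have hB := bernoulliExp_pos (T := T) hp hF
    have e1 : bernoulliExp p T (fun S => ∑ k ∈ insert a T, entropyTerm F k (insert a S)) =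
        bernoulliExp p T (fun S => ∑ k ∈ T, entropyTerm (fun S => F (insert a S)) k S) +
        (bernoulliExp p T (fun S => F (insert a S) * Real.log (F (insert a S) / F S)) +
          (-1 * bernoulliExp p T (fun S => F (insert a S)) + bernoulliExp p T F)) := by
      rw [← bernoulliExp_const_mul, ← bernoulliExp_add, ← bernoulliExp_add, ← bernoulliExp_add]
      refine bernoulliExp_congr fun S hS => ?_
      have haS : a ∉ S := fun h => ha (hS h)
      rw [Finset.sum_insert ha, add_comm]
      congr 1
      · refine Finset.sum_congr rfl fun k hk => ?_
        have hka : k ≠ a := fun h => ha (h ▸ hk)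
        simp [entropyTerm, hka, Finset.erase_insert_of_ne hka.symm]
      · simp [entropyTerm, haS]; ring
    have e0 : bernoulliExp p T (fun S => ∑ k ∈ insert a T, entropyTerm F k S) =
        bernoulliExp p T (fun S => ∑ k ∈ T, entropyTerm F k S) := by
      refine bernoulliExp_congr fun S hS => ?_
      have haS : a ∉ S := fun h => ha (hS h)
      rw [Finset.sum_insert ha]
      simp [entropyTerm, haS]
    rw [bernoulliExp_insert p ha, bernoulliExp_insert p ha, bernoulliExp_insert p ha, e1, e0]
    set A := bernoulliExp p T (fun S => F (insert a S))
    set B := bernoulliExp p T F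
    have hp0 := (hp a).1
    have hq0 := sub_nonneg.2 (hp a).2
    have hC : 0 < p a * A + (1 - p a) * B := by
      rcases hp0.eq_or_lt with h0 | h0
      · rw [← h0]; simpa using hB
      · exact add_pos_of_pos_of_nonneg (mul_pos h0 hA) (mul_nonneg hq0 hB.le)
    set C := p a * A + (1 - p a) * B with hCdef
    have hClog : C * Real.log B + C - B ≤ C * Real.log C := by
      have h1 := Real.log_le_sub_one_of_pos (div_pos hB hC)
      rw [Real.log_div hB.ne' hC.ne'] at h1
      have h2 := mul_le_mul_of_nonneg_left h1 hC.le
      have h3 : C * (B / C - 1) = B - C := by field_simp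
      linarith
    rw [Real.log_div hA.ne' hB.ne'] at hls
    have m1 := mul_le_mul_of_nonneg_left ih1 hp0
    have m0 := mul_le_mul_of_nonneg_left ih0 hq0
    have ml := mul_le_mul_of_nonneg_left hls hp0
    rw [hCdef] at hClog ⊢
    nlinarith

end bernoulliExp

/-- If `(x - 1) Λ'(x) ≤ Λ(x)` on `(0, ∞)` and `Λ(1) = 0`, then `Λ` lies below its tangent line
at `1`. -/
lemma le_tangent_of_sub_one_mul_deriv_le {f f' : ℝ → ℝ} (hf : ∀ x, 0 < x → HasDerivAt f (f' x) x)
    (h1 : f 1 = 0) (hle : ∀ x, 0 < x → (x - 1) * f' x ≤ f x) {x : ℝ} (hx : 0 < x) :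
    f x ≤ (x - 1) * f' 1 := by
  have hone : dslope f 1 1 = f' 1 := by rw [dslope_same, (hf 1 one_pos).deriv]
  have hval : ∀ y, y ≠ 1 → dslope f 1 y = f y / (y - 1) := fun y hy => by
    rw [dslope_of_ne _ hy, slope_def_field, h1, sub_zero]
  have hcont : ∀ y, 0 < y → ContinuousAt (dslope f 1) y := by
    intro y hy
    rcases eq_or_ne y 1 with rfl | hne
    · exact continuousAt_dslope_same.2 (hf 1 hy).differentiableAt
    · exact (continuousAt_dslope_of_ne hne).2 (hf y hy).continuousAt
  have hder : ∀ y, 0 < y → y ≠ 1 →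
      HasDerivAt (dslope f 1) ((f' y * (y - 1) - f y * 1) / (y - 1) ^ 2) y := by
    intro y hy hne
    have h := (hf y hy).div ((hasDerivAt_id y).sub_const 1) (sub_ne_zero.2 hne)
    refine h.congr_of_eventuallyEq ?_
    filter_upwards [isOpen_ne.mem_nhds hne] with z hz
    exact hval z hz
  have hneg : ∀ y, 0 < y → (f' y * (y - 1) - f y * 1) / (y - 1) ^ 2 ≤ 0 := fun y hy =>
    div_nonpos_of_nonpos_of_nonneg (by linarith [hle y hy, mul_comm (f' y) (y - 1)]) (sq_nonneg _)
  rcases lt_trichotomy x 1 with hlt | rfl | hgt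
  · have hanti : AntitoneOn (dslope f 1) (Icc x 1) := by
      refine antitoneOn_of_deriv_nonpos (convex_Icc _ _)
        (fun y hy => (hcont y (hx.trans_le hy.1)).continuousWithinAt) ?_ ?_ <;>
      intro y hy <;> rw [interior_Icc] at hy
      · exact (hder y (hx.trans hy.1) hy.2.ne).differentiableAt.differentiableWithinAt
      · rw [(hder y (hx.trans hy.1) hy.2.ne).deriv]; exact hneg y (hx.trans hy.1)
    have h := hanti (left_mem_Icc.2 hlt.le) (right_mem_Icc.2 hlt.le) hlt.le
    rw [hone, hval x hlt.ne, le_div_iff_of_neg (by linarith)] at h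
    linarith
  · simp [h1]
  · have hanti : AntitoneOn (dslope f 1) (Icc 1 x) := by
      refine antitoneOn_of_deriv_nonpos (convex_Icc _ _)
        (fun y hy => (hcont y (one_pos.trans_le hy.1)).continuousWithinAt) ?_ ?_ <;>
      intro y hy <;> rw [interior_Icc] at hy
      · exact (hder y (one_pos.trans hy.1) hy.1.ne').differentiableAt.differentiableWithinAt
      · rw [(hder y (one_pos.trans hy.1) hy.1.ne').deriv]; exact hneg y (one_pos.trans hy.1)
    have h := hanti (left_mem_Icc.2 hgt.le) (right_mem_Icc.2 hgt.le) hgt.le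
    rw [hone, hval x hgt.ne', div_le_iff₀ (by linarith)] at h
    linarith

section maxCard

variable {K : Type*} {𝓒 : Finset K → Prop}

open Classical in
/-- The maximal cardinality of a member of the family `𝓒` contained in `S`. -/
def maxCard (𝓒 : Finset K → Prop) (S : Finset K) : ℕ := (S.powerset.filter 𝓒).sup Finset.card

lemma card_le_maxCard {S C : Finset K} (hC : 𝓒 C) (hCS : C ⊆ S) : C.card ≤ maxCard 𝓒 S := by
  classical
  exact Finset.le_sup (f := Finset.card) (by simp [hC, hCS])

lemma maxCard_mono : Monotone (maxCard 𝓒) := by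
  classical
  intro S S' h
  refine Finset.sup_le fun C hC => ?_
  rw [Finset.mem_filter, Finset.mem_powerset] at hC
  exact card_le_maxCard hC.2 (hC.1.trans h)

lemma exists_card_eq_maxCard (h0 : 𝓒 ∅) (S : Finset K) :
    ∃ C ⊆ S, 𝓒 C ∧ C.card = maxCard 𝓒 S := by
  classical
  obtain ⟨C, hC, h⟩ := Finset.exists_mem_eq_sup (S.powerset.filter 𝓒)
    ⟨∅, by simp [h0]⟩ Finset.card
  rw [Finset.mem_filter, Finset.mem_powerset] at hC
  exact ⟨C, hC.1, hC.2, h.symm⟩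

variable [DecidableEq K]

lemma maxCard_le_maxCard_erase_add_one (h0 : 𝓒 ∅) (hered : ∀ C D, D ⊆ C → 𝓒 C → 𝓒 D)
    (S : Finset K) (k : K) : maxCard 𝓒 S ≤ maxCard 𝓒 (S.erase k) + 1 := by
  obtain ⟨C, hCS, hC, hcard⟩ := exists_card_eq_maxCard h0 S
  have := card_le_maxCard (hered C _ (C.erase_subset k) hC) (Finset.erase_subset_erase k hCS)
  have := Finset.pred_card_le_card_erase (s := C) (a := k)
  omega

/-- A maximal cardinality is self-bounding: the number of its pivotal elements is at most
its value. -/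
lemma sum_maxCard_sub_erase_le (h0 : 𝓒 ∅) (hered : ∀ C D, D ⊆ C → 𝓒 C → 𝓒 D) (S : Finset K) :
    ∑ k ∈ S, ((maxCard 𝓒 S : ℝ) - maxCard 𝓒 (S.erase k)) ≤ maxCard 𝓒 S := by
  obtain ⟨C, hCS, hC, hcard⟩ := exists_card_eq_maxCard h0 S
  rw [← Finset.sum_subset hCS fun k _ hk => ?_]
  · calc ∑ k ∈ C, ((maxCard 𝓒 S : ℝ) - maxCard 𝓒 (S.erase k)) ≤ ∑ k ∈ C, (1 : ℝ) := by
          refine Finset.sum_le_sum fun k _ => ?_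
          have := maxCard_le_maxCard_erase_add_one h0 hered S k
          have : (maxCard 𝓒 S : ℝ) ≤ maxCard 𝓒 (S.erase k) + 1 := by exact_mod_cast this
          linarith
      _ = maxCard 𝓒 S := by simp [hcard]
  · have h1 := card_le_maxCard hC (Finset.subset_erase.2 ⟨hCS, hk⟩)
    have h2 : maxCard 𝓒 (S.erase k) ≤ maxCard 𝓒 S := maxCard_mono (S.erase_subset k)
    rw [hcard] at h1
    rw [le_antisymm h2 h1, sub_self]

/-- The longest member of a hereditary family inside a Bernoulli random set has moment generating
function bounded by that of the Poisson law with the same mean. -/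
theorem bernoulliExp_pow_maxCard_le (h0 : 𝓒 ∅) (hered : ∀ C D, D ⊆ C → 𝓒 C → 𝓒 D)
    {p : K → ℝ} (hp : ∀ k, p k ∈ Icc (0 : ℝ) 1) (T : Finset K) {x : ℝ} (hx : 0 < x) :
    bernoulliExp p T (fun S => x ^ maxCard 𝓒 S) ≤
      Real.exp ((x - 1) * bernoulliExp p T (fun S => (maxCard 𝓒 S : ℝ))) := by
  set Z := maxCard 𝓒 with hZ
  set g : ℝ → ℝ := fun y => bernoulliExp p T (fun S => y ^ Z S) with hg
  set g' : ℝ → ℝ := fun y => bernoulliExp p T (fun S => Z S * y ^ (Z S - 1)) with hg'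
  have hgpos : ∀ y, 0 < y → 0 < g y := fun y hy => bernoulliExp_pos hp fun S => pow_pos hy _
  have hder : ∀ y, HasDerivAt g (g' y) y := by
    intro y
    simp only [hg, hg', bernoulliExp]
    exact HasDerivAt.fun_sum fun S _ => (hasDerivAt_pow (Z S) y).const_mul _
  have hg1 : g 1 = 1 := by simp [hg, bernoulliExp_const]
  have hle : ∀ y, 0 < y → (y - 1) * (g' y / g y) ≤ Real.log (g y) := by
    intro y hy
    have hent := entropy_le_bernoulliExp (T := T) hp (F := fun S => y ^ Z S) fun S => pow_pos hy _
    have hmul : bernoulliExp p T (fun S => Z S * y ^ Z S) = y * g' y := by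
      rw [← bernoulliExp_const_mul]
      refine bernoulliExp_congr fun S _ => ?_
      rcases Nat.eq_zero_or_pos (Z S) with h | h
      · simp [h]
      · obtain ⟨n, hn⟩ := Nat.exists_eq_add_of_lt h
        rw [hn]; simp [pow_succ]; ring
    have e1 : bernoulliExp p T (fun S => y ^ Z S * Real.log (y ^ Z S)) =
        Real.log y * (y * g' y) := by
      rw [← hmul, ← bernoulliExp_const_mul]
      exact bernoulliExp_congr fun S _ => by rw [Real.log_pow]; ring
    have hφ : 0 ≤ Real.log y - 1 + 1 / y := by
      have := Real.one_sub_inv_le_log_of_pos hy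
      rw [one_div]; linarith
    have e2 : bernoulliExp p T (fun S => ∑ k ∈ T, entropyTerm (fun S => y ^ Z S) k S) ≤
        (Real.log y - 1 + 1 / y) * (y * g' y) := by
      rw [← hmul, ← bernoulliExp_const_mul]
      refine bernoulliExp_mono hp fun S hS => ?_
      have hterm : ∀ k ∈ S, entropyTerm (fun S => y ^ Z S) k S =
          (Real.log y - 1 + 1 / y) * y ^ Z S * ((Z S : ℝ) - Z (S.erase k)) := by
        intro k hk
        have hmono : Z (S.erase k) ≤ Z S := maxCard_mono (S.erase_subset k)
        have hstep := maxCard_le_maxCard_erase_add_one h0 hered S k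
        rw [← hZ] at hstep
        simp only [entropyTerm, hk, if_true]
        rcases hmono.eq_or_lt with h | h
        · rw [h, div_self (pow_pos hy _).ne']; simp
        · have h' : Z S = Z (S.erase k) + 1 := by omega
          rw [h', pow_succ, mul_div_cancel_left₀ _ (pow_pos hy _).ne']
          push_cast
          field_simp
          ring
      have hsum : ∑ k ∈ T, entropyTerm (fun S => y ^ Z S) k S =
          ∑ k ∈ S, entropyTerm (fun S => y ^ Z S) k S :=
        (Finset.sum_subset hS fun k _ hk => by simp [entropyTerm, hk]).symm
      rw [hsum, Finset.sum_congr rfl hterm, ← Finset.mul_sum, mul_assoc, mul_comm (y ^ Z S)]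
      exact mul_le_mul_of_nonneg_left (mul_le_mul_of_nonneg_right
        (sum_maxCard_sub_erase_le h0 hered S) (pow_pos hy _).le) hφ
    rw [e1] at hent
    have h := hent.trans e2
    change Real.log y * (y * g' y) - g y * Real.log (g y) ≤ _ at h
    have hexp : (Real.log y - 1 + 1 / y) * (y * g' y) =
        Real.log y * (y * g' y) - (y - 1) * g' y := by field_simp; ring
    rw [← mul_div_assoc, div_le_iff₀ (hgpos y hy)]
    linarith
  have hmain := le_tangent_of_sub_one_mul_deriv_le (f := fun y => Real.log (g y))
    (f' := fun y => g' y / g y) (fun y hy => (hder y).log (hgpos y hy).ne') (by simp [hg1]) hle hx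
  have hmean : g' 1 / g 1 = bernoulliExp p T (fun S => (Z S : ℝ)) := by simp [hg1, hg']
  rw [hmean] at hmain
  exact (Real.log_le_iff_le_exp (hgpos x hx)).1 hmain

end maxCard

section tails

variable {K : Type*} {𝓒 : Finset K → Prop} [DecidableEq K]

open Classical in
/-- Chernoff bound for the upper (`0 ≤ θ`) and lower (`θ ≤ 0`) tails of `maxCard`. -/
lemma bernoulliExp_tail_le (h0 : 𝓒 ∅) (hered : ∀ C D, D ⊆ C → 𝓒 C → 𝓒 D)
    {p : K → ℝ} (hp : ∀ k, p k ∈ Icc (0 : ℝ) 1) (T : Finset K) (θ t : ℝ) {U : Set ℕ}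
    (hU : ∀ n ∈ U, θ * t ≤ θ * n) :
    bernoulliExp p T (fun S => if maxCard 𝓒 S ∈ U then 1 else 0) ≤
      Real.exp (-(θ * t)) * Real.exp ((Real.exp θ - 1) *
        bernoulliExp p T (fun S => (maxCard 𝓒 S : ℝ))) := by
  refine le_trans ?_ (mul_le_mul_of_nonneg_left
    (bernoulliExp_pow_maxCard_le h0 hered hp T (Real.exp_pos θ)) (Real.exp_pos _).le)
  rw [← bernoulliExp_const_mul]
  refine bernoulliExp_mono hp fun S _ => ?_
  split_ifs with h
  · rw [← Real.exp_nat_mul, ← Real.exp_add, Real.one_le_exp_iff]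
    linarith [hU _ h]
  · positivity

end tails

section law

variable {K : Type*} [DecidableEq K]

lemma eq_of_sum_powerset_eq {w₁ w₂ : Finset K → ℝ}
    (h : ∀ T : Finset K, ∑ S ∈ T.powerset, w₁ S = ∑ S ∈ T.powerset, w₂ S) : w₁ = w₂ := by
  funext T
  induction T using Finset.strongInduction with
  | H T ih =>
    have hT := h T
    rw [← Finset.add_sum_erase _ _ (Finset.mem_powerset_self T),
      ← Finset.add_sum_erase _ w₂ (Finset.mem_powerset_self T)] at hT
    have : ∑ S ∈ T.powerset.erase T, w₁ S = ∑ S ∈ T.powerset.erase T, w₂ S :=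
      Finset.sum_congr rfl fun S hS => ih S (Finset.mem_ssubsets.1 hS)
    linarith

variable [Fintype K]

/-- A law on finite sets whose void probabilities are those of the Bernoulli law is the
Bernoulli law. -/
lemma sum_mul_eq_bernoulliExp {p : K → ℝ} {q : Finset K → ℝ}
    (h : ∀ T : Finset K, ∑ S ∈ T.powerset, q S = ∏ k ∈ Tᶜ, (1 - p k)) (F : Finset K → ℝ) :
    ∑ S, q S * F S = bernoulliExp p Finset.univ F := by
  have hw : q = fun S => (∏ k ∈ S, p k) * ∏ k ∈ Finset.univ \ S, (1 - p k) := by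
    refine eq_of_sum_powerset_eq fun T => ?_
    rw [h T]
    have hsplit : ∀ S ∈ T.powerset, (∏ k ∈ S, p k) * ∏ k ∈ Finset.univ \ S, (1 - p k) =
        (∏ k ∈ Tᶜ, (1 - p k)) * ((∏ k ∈ S, p k) * ∏ k ∈ T \ S, (1 - p k)) := by
      intro S hS
      have hST := Finset.mem_powerset.1 hS
      have hdisj : Disjoint Tᶜ (T \ S) :=
        Finset.disjoint_left.2 fun k hk hk' => Finset.mem_compl.1 hk (Finset.mem_sdiff.1 hk').1
      have hunion : Finset.univ \ S = Tᶜ ∪ (T \ S) := by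
        ext k
        have := @hST k
        simp only [Finset.mem_sdiff, Finset.mem_univ, true_and, Finset.mem_union,
          Finset.mem_compl]
        tauto
      rw [hunion, Finset.prod_union hdisj]
      ring
    rw [Finset.sum_congr rfl hsplit, ← Finset.mul_sum, ← Finset.prod_add]
    simp
  rw [hw, bernoulliExp, Finset.powerset_univ]

variable {Ω : Type*} [MeasurableSpace Ω] {P : Measure Ω} [IsProbabilityMeasure P]
  {occ : Ω → Finset K}

lemma measurableSet_occ_eq (hocc : ∀ k, MeasurableSet {ω | k ∈ occ ω}) (S : Finset K) :
    MeasurableSet {ω | occ ω = S} := by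
  have : {ω | occ ω = S} = ⋂ k, {ω | k ∈ occ ω ↔ k ∈ S} := by
    ext ω; simp [Finset.ext_iff]
  rw [this]
  refine MeasurableSet.iInter fun k => ?_
  by_cases hk : k ∈ S
  · simpa [hk] using hocc k
  · simp only [hk, iff_false]; exact (hocc k).compl

lemma measureReal_occ_mem (hocc : ∀ k, MeasurableSet {ω | k ∈ occ ω}) (A : Finset (Finset K)) :
    P.real {ω | occ ω ∈ A} = ∑ S ∈ A, P.real {ω | occ ω = S} := by
  rw [← measureReal_biUnion_finset]
  · congr 1; ext ω; simp
  · intro S _ S' _ hne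
    exact Set.disjoint_left.2 fun ω h h' => hne (h.symm.trans h')
  · exact fun S _ => measurableSet_occ_eq hocc S

lemma sum_mul_eq_integral (hocc : ∀ k, MeasurableSet {ω | k ∈ occ ω}) (F : Finset K → ℝ) :
    Integrable (fun ω => F (occ ω)) P ∧
      ∫ ω, F (occ ω) ∂P = ∑ S, P.real {ω | occ ω = S} * F S := by
  have hF : (fun ω => F (occ ω)) =
      fun ω => ∑ S, {ω | occ ω = S}.indicator (fun _ => F S) ω := by
    funext ω
    simp [Set.indicator_apply]
  have hintg : ∀ S ∈ Finset.univ, Integrable ({ω | occ ω = S}.indicator (fun _ => F S)) P :=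
    fun S _ => (integrable_const _).indicator (measurableSet_occ_eq hocc S)
  rw [hF]
  refine ⟨integrable_finsetSum _ hintg, ?_⟩
  rw [integral_finsetSum _ hintg]
  refine Finset.sum_congr rfl fun S _ => ?_
  rw [integral_indicator_const _ (measurableSet_occ_eq hocc S), smul_eq_mul]

open Classical in
lemma measureReal_occ_eq_bernoulliExp {p : K → ℝ} (hocc : ∀ k, MeasurableSet {ω | k ∈ occ ω})
    (h : ∀ T : Finset K, P.real {ω | occ ω ⊆ T} = ∏ k ∈ Tᶜ, (1 - p k)) (Q : Finset K → Prop) :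
    P.real {ω | Q (occ ω)} = bernoulliExp p Finset.univ (fun S => if Q S then 1 else 0) := by
  rw [← sum_mul_eq_bernoulliExp (q := fun S => P.real {ω | occ ω = S})]
  · have := measureReal_occ_mem (P := P) hocc (Finset.univ.filter Q)
    simp only [Finset.mem_filter, Finset.mem_univ, true_and] at this
    rw [this, Finset.sum_filter]
    simp
  · intro T
    rw [← measureReal_occ_mem hocc, ← h T]
    simp

end law

lemma chainLength_mono {d : ℕ} {A B : Set (Fin d → ℝ)} (hAB : A ⊆ B) (hB : B.Finite) :
    chainLength d A ≤ chainLength d B := by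
  refine csSup_le_csSup ⟨hB.toFinset.card, ?_⟩ ⟨0, ∅, by simp⟩ ?_
  · rintro n ⟨C, hC, -, rfl⟩
    exact Finset.card_le_card fun z hz => hB.mem_toFinset.2 (hC hz)
  · rintro n ⟨C, hC, hchain, hcard⟩
    exact ⟨C, hC.trans hAB, hchain, hcard⟩

lemma card_le_chainLength {d : ℕ} {A : Set (Fin d → ℝ)} (hA : A.Finite)
    {C : Finset (Fin d → ℝ)} (hCA : ↑C ⊆ A) (hC : IsChain (· ≤ ·) (C : Set (Fin d → ℝ))) :
    C.card ≤ chainLength d A := by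
  refine le_csSup ⟨hA.toFinset.card, ?_⟩ ⟨C, hCA, hC, rfl⟩
  rintro n ⟨C, hC, -, rfl⟩
  exact Finset.card_le_card fun z hz => hA.mem_toFinset.2 (hC hz)

lemma chainLength_le {d : ℕ} {A : Set (Fin d → ℝ)} {N : ℕ}
    (h : ∀ C : Finset (Fin d → ℝ), ↑C ⊆ A → IsChain (· ≤ ·) (C : Set (Fin d → ℝ)) → C.card ≤ N) :
    chainLength d A ≤ N := by
  refine csSup_le ⟨0, ∅, by simp⟩ ?_
  rintro n ⟨C, hCA, hC, rfl⟩
  exact h C hCA hC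

section grid

variable {d : ℕ}

/-- The half-open box `∏ [a_i, b_i)`. -/
def halfOpenBox (a b : Fin d → ℝ) : Set (Fin d → ℝ) := Set.pi univ fun i => Ico (a i) (b i)

lemma mem_halfOpenBox {a b z : Fin d → ℝ} :
    z ∈ halfOpenBox a b ↔ ∀ i, a i ≤ z i ∧ z i < b i := by simp [halfOpenBox]

lemma measurableSet_halfOpenBox (a b : Fin d → ℝ) : MeasurableSet (halfOpenBox a b) :=
  MeasurableSet.univ_pi fun _ => measurableSet_Ico

lemma halfOpenBox_subset_Icc (a b : Fin d → ℝ) : halfOpenBox a b ⊆ Icc a b := fun _ hz =>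
  ⟨fun i => (mem_halfOpenBox.1 hz i).1, fun i => (mem_halfOpenBox.1 hz i).2.le⟩

lemma isBounded_halfOpenBox (a b : Fin d → ℝ) : Bornology.IsBounded (halfOpenBox a b) :=
  (Metric.isBounded_Icc a b).subset (halfOpenBox_subset_Icc a b)

lemma volume_halfOpenBox {a b : Fin d → ℝ} (hab : ∀ i, a i ≤ b i) :
    volume.real (halfOpenBox a b) = ∏ i, (b i - a i) := by
  rw [measureReal_def, halfOpenBox, Real.volume_pi_Ico_toReal hab]

/-- The `j`-th of the `m + 1` points dividing `[s, t]` into `m` equal parts. -/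
def gridPoint (s t : ℝ) (m j : ℕ) : ℝ := s + (t - s) * (j / m)

lemma gridPoint_mono {s t : ℝ} (hst : s < t) {m j k : ℕ} (hjk : j ≤ k) :
    gridPoint s t m j ≤ gridPoint s t m k := by
  unfold gridPoint
  have : (j : ℝ) ≤ k := by exact_mod_cast hjk
  have := sub_pos.2 hst
  gcongr

lemma gridPoint_succ_sub (s t : ℝ) (m j : ℕ) :
    gridPoint s t m (j + 1) - gridPoint s t m j = (t - s) / m := by
  unfold gridPoint; push_cast; ring

lemma le_gridPoint {s t : ℝ} (hst : s < t) (m j : ℕ) : s ≤ gridPoint s t m j := by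
  have := sub_pos.2 hst
  unfold gridPoint
  have : 0 ≤ (t - s) * ((j : ℝ) / m) := by positivity
  linarith

lemma gridPoint_le {s t : ℝ} (hst : s < t) {m j : ℕ} (hjm : j ≤ m) : gridPoint s t m j ≤ t := by
  have h1 : (j : ℝ) / m ≤ 1 := div_le_one_of_le₀ (by exact_mod_cast hjm) (by positivity)
  have := mul_le_mul_of_nonneg_left h1 (sub_pos.2 hst).le
  unfold gridPoint
  linarith

lemma exists_gridPoint_le_lt {s t z : ℝ} (hst : s < t) {m : ℕ} (hm : 0 < m) (h1 : s ≤ z)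
    (h2 : z < t) : ∃ j : Fin m, gridPoint s t m j ≤ z ∧ z < gridPoint s t m (j + 1) := by
  have hts := sub_pos.2 hst
  have hm' : (0 : ℝ) < m := by exact_mod_cast hm
  have hr0 : 0 ≤ (z - s) / (t - s) * m := by
    have := sub_nonneg.2 h1
    positivity
  have hrm : (z - s) / (t - s) * m < m := by
    have : (z - s) / (t - s) < 1 := by rw [div_lt_one hts]; linarith
    nlinarith
  refine ⟨⟨⌊(z - s) / (t - s) * m⌋₊, (Nat.floor_lt hr0).2 hrm⟩, ?_, ?_⟩
  · have := Nat.floor_le hr0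
    rw [← div_le_iff₀ hm', le_div_iff₀ hts] at this
    simp only [gridPoint]
    linarith [mul_comm (t - s) ((⌊(z - s) / (t - s) * m⌋₊ : ℝ) / m)]
  · have := Nat.lt_floor_add_one ((z - s) / (t - s) * m)
    rw [← lt_div_iff₀ hm', div_lt_iff₀ hts] at this
    simp only [gridPoint]
    push_cast
    linarith [mul_comm (t - s) (((⌊(z - s) / (t - s) * m⌋₊ : ℝ) + 1) / m)]

variable (a b : Fin d → ℝ) (m : ℕ)

/-- The `j`-th of the `m` slabs orthogonal to the `i`-th axis dividing `halfOpenBox a b`. -/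
def gridSlab (i : Fin d) (j : Fin m) : Set (Fin d → ℝ) :=
  halfOpenBox (Function.update a i (gridPoint (a i) (b i) m j))
    (Function.update b i (gridPoint (a i) (b i) m (j + 1)))

/-- The cell with index `κ` of the division of `halfOpenBox a b` into `m ^ d` congruent boxes. -/
def gridCell (κ : Fin d → Fin m) : Set (Fin d → ℝ) :=
  halfOpenBox (fun i => gridPoint (a i) (b i) m (κ i))
    (fun i => gridPoint (a i) (b i) m (κ i + 1))

variable {a b m}

lemma mem_gridCell {κ : Fin d → Fin m} {z : Fin d → ℝ} : z ∈ gridCell a b m κ ↔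
    ∀ i, gridPoint (a i) (b i) m (κ i) ≤ z i ∧ z i < gridPoint (a i) (b i) m (κ i + 1) :=
  mem_halfOpenBox

lemma gridCell_subset (hab : ∀ i, a i < b i) (κ : Fin d → Fin m) :
    gridCell a b m κ ⊆ halfOpenBox a b := fun _ hz => mem_halfOpenBox.2 fun i =>
  ⟨(le_gridPoint (hab i) _ _).trans (mem_gridCell.1 hz i).1,
    (mem_gridCell.1 hz i).2.trans_le (gridPoint_le (hab i) (κ i).2)⟩

lemma lt_of_mem_gridCell (hab : ∀ i, a i < b i) {κ κ' : Fin d → Fin m} {z z' : Fin d → ℝ}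
    (hz : z ∈ gridCell a b m κ) (hz' : z' ∈ gridCell a b m κ') {i : Fin d} (h : κ i < κ' i) :
    z i < z' i :=
  (mem_gridCell.1 hz i).2.trans_le ((gridPoint_mono (hab i) h).trans (mem_gridCell.1 hz' i).1)

lemma gridCell_eq_of_mem (hab : ∀ i, a i < b i) {κ κ' : Fin d → Fin m} {z : Fin d → ℝ}
    (hz : z ∈ gridCell a b m κ) (hz' : z ∈ gridCell a b m κ') : κ = κ' := by
  funext i
  by_contra hne
  rcases lt_or_gt_of_ne hne with h | h
  · exact lt_irrefl _ (lt_of_mem_gridCell hab hz hz' h)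
  · exact lt_irrefl _ (lt_of_mem_gridCell hab hz' hz h)

lemma disjoint_gridCell (hab : ∀ i, a i < b i) {κ κ' : Fin d → Fin m} (hne : κ ≠ κ') :
    Disjoint (gridCell a b m κ) (gridCell a b m κ') :=
  Set.disjoint_left.2 fun _ hz hz' => hne (gridCell_eq_of_mem hab hz hz')

lemma exists_mem_gridCell (hab : ∀ i, a i < b i) (hm : 0 < m) {z : Fin d → ℝ}
    (hz : z ∈ halfOpenBox a b) : ∃ κ, z ∈ gridCell a b m κ := by
  choose κ hκ using fun i => exists_gridPoint_le_lt (hab i) hm (mem_halfOpenBox.1 hz i).1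
    (mem_halfOpenBox.1 hz i).2
  exact ⟨κ, mem_gridCell.2 hκ⟩

lemma gridCell_subset_gridSlab (hab : ∀ i, a i < b i) (κ : Fin d → Fin m) (i : Fin d) :
    gridCell a b m κ ⊆ gridSlab a b m i (κ i) := by
  intro z hz
  refine mem_halfOpenBox.2 fun k => ?_
  rcases eq_or_ne k i with rfl | hne
  · simpa using mem_gridCell.1 hz k
  · simpa [hne] using mem_halfOpenBox.1 (gridCell_subset hab κ hz) k

lemma measurableSet_gridCell (κ : Fin d → Fin m) : MeasurableSet (gridCell a b m κ) :=
  measurableSet_halfOpenBox _ _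

lemma volume_gridCell (hab : ∀ i, a i < b i) (κ : Fin d → Fin m) :
    volume.real (gridCell a b m κ) = (∏ i, (b i - a i)) / (m : ℝ) ^ d := by
  rw [gridCell, volume_halfOpenBox fun i => gridPoint_mono (hab i) (Nat.le_succ _)]
  simp [gridPoint_succ_sub, Finset.prod_div_distrib]

lemma volume_gridSlab (hab : ∀ i, a i < b i) (i : Fin d) (j : Fin m) :
    volume.real (gridSlab a b m i j) = (∏ i, (b i - a i)) / m := by
  rw [gridSlab, volume_halfOpenBox]
  · rw [← Finset.mul_prod_erase _ _ (Finset.mem_univ i),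
      ← Finset.mul_prod_erase _ (fun i => b i - a i) (Finset.mem_univ i)]
    have : ∀ k ∈ Finset.univ.erase i,
        Function.update b i (gridPoint (a i) (b i) m (j + 1)) k -
          Function.update a i (gridPoint (a i) (b i) m j) k = b k - a k := by
      intro k hk
      simp [Finset.ne_of_mem_erase hk]
    rw [Finset.prod_congr rfl this]
    simp [gridPoint_succ_sub]
    ring
  · intro k
    rcases eq_or_ne k i with rfl | hne
    · simpa using gridPoint_mono (hab k) (Nat.le_succ _)
    · simpa [hne] using (hab k).le

lemma gridSlab_subset (hab : ∀ i, a i < b i) (i : Fin d) (j : Fin m) :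
    gridSlab a b m i j ⊆ halfOpenBox a b := by
  intro z hz
  refine mem_halfOpenBox.2 fun k => ?_
  have h := mem_halfOpenBox.1 hz k
  rcases eq_or_ne k i with rfl | hne
  · simp only [Function.update_self] at h
    exact ⟨(le_gridPoint (hab k) _ _).trans h.1, h.2.trans_le (gridPoint_le (hab k) j.2)⟩
  · simpa [hne] using h

/-- Sets of cell indices which are chains for the order requiring strict increase in every
coordinate. -/
def IsStrictChain (C : Finset (Fin d → Fin m)) : Prop :=
  ∀ κ ∈ C, ∀ κ' ∈ C, κ ≠ κ' → (∀ i, κ i < κ' i) ∨ ∀ i, κ' i < κ i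

lemma isStrictChain_empty : IsStrictChain (∅ : Finset (Fin d → Fin m)) := by
  simp [IsStrictChain]

lemma IsStrictChain.subset (C D : Finset (Fin d → Fin m)) (h : D ⊆ C) (hC : IsStrictChain C) :
    IsStrictChain D := fun κ hκ κ' hκ' => hC κ (h hκ) κ' (h hκ')

variable (a b m) in
open Classical in
/-- The indices of the grid cells meeting `A`. -/
def occupiedCells (A : Set (Fin d → ℝ)) : Finset (Fin d → Fin m) :=
  Finset.univ.filter fun κ => (A ∩ gridCell a b m κ).Nonempty

lemma mem_occupiedCells {A : Set (Fin d → ℝ)} {κ : Fin d → Fin m} :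
    κ ∈ occupiedCells a b m A ↔ (A ∩ gridCell a b m κ).Nonempty := by
  simp [occupiedCells]

variable (m) in
/-- The length of the longest chain of cells contained in `S`. -/
abbrev cellChainLength : Finset (Fin d → Fin m) → ℕ := maxCard IsStrictChain

lemma cellChainLength_le_chainLength (hab : ∀ i, a i < b i) {A : Set (Fin d → ℝ)}
    (hA : A.Finite) : cellChainLength m (occupiedCells a b m A) ≤ chainLength d A := by
  classical
  obtain ⟨C, hCS, hC, hcard⟩ := exists_card_eq_maxCard (𝓒 := IsStrictChain) isStrictChain_empty
    (occupiedCells a b m A)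
  have hex : ∀ κ ∈ C, ∃ z, z ∈ A ∧ z ∈ gridCell a b m κ := fun κ hκ =>
    mem_occupiedCells.1 (hCS hκ)
  choose! r hrA hr using hex
  have hinj : InjOn r C := fun κ hκ κ' hκ' h =>
    gridCell_eq_of_mem hab (hr κ hκ) (h ▸ hr κ' hκ')
  rw [cellChainLength, ← hcard, ← Finset.card_image_of_injOn hinj]
  refine card_le_chainLength hA ?_ ?_
  · intro z hz
    simp only [Finset.coe_image, Set.mem_image, Finset.mem_coe] at hz
    obtain ⟨κ, hκ, rfl⟩ := hz
    exact hrA κ hκ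
  · intro z hz z' hz' hne
    simp only [Finset.coe_image, Set.mem_image, Finset.mem_coe] at hz hz'
    obtain ⟨κ, hκ, rfl⟩ := hz
    obtain ⟨κ', hκ', rfl⟩ := hz'
    rcases hC κ hκ κ' hκ' (fun h => hne (h ▸ rfl)) with h | h
    · exact Or.inl fun i => (lt_of_mem_gridCell hab (hr κ hκ) (hr κ' hκ') (h i)).le
    · exact Or.inr fun i => (lt_of_mem_gridCell hab (hr κ' hκ') (hr κ hκ) (h i)).le

lemma chainLength_le_cellChainLength (hab : ∀ i, a i < b i) (hm : 0 < m)
    {A : Set (Fin d → ℝ)} (hA : A ⊆ halfOpenBox a b)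
    (hslab : ∀ i j, (A ∩ gridSlab a b m i j).Subsingleton) :
    chainLength d A ≤ cellChainLength m (occupiedCells a b m A) := by
  classical
  refine chainLength_le fun C hCA hC => ?_
  have : NeZero m := ⟨hm.ne'⟩
  have hex : ∀ z ∈ C, ∃ κ, z ∈ gridCell a b m κ := fun z hz =>
    exists_mem_gridCell hab hm (hA (hCA hz))
  choose! r hr using hex
  have hne : ∀ z ∈ C, ∀ z' ∈ C, z ≠ z' → ∀ i, r z i ≠ r z' i := by
    intro z hz z' hz' hzz i heq
    refine hzz (hslab i (r z i) ⟨hCA hz, gridCell_subset_gridSlab hab _ i (hr z hz)⟩ ⟨hCA hz', ?_⟩)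
    rw [heq]
    exact gridCell_subset_gridSlab hab _ i (hr z' hz')
  have hlt : ∀ z ∈ C, ∀ z' ∈ C, z ≠ z' → z ≤ z' → ∀ i, r z i < r z' i := by
    intro z hz z' hz' hzz hle i
    refine lt_of_le_of_ne (not_lt.1 fun h => ?_) (hne z hz z' hz' hzz i)
    exact (lt_of_mem_gridCell hab (hr z' hz') (hr z hz) h).not_ge (hle i)
  have hinj : InjOn r C := by
    intro z hz z' hz' h
    by_contra hzz
    obtain ⟨i, -⟩ := Function.ne_iff.1 hzz
    exact hne z hz z' hz' hzz i (by rw [h])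
  rw [← Finset.card_image_of_injOn hinj]
  refine card_le_maxCard ?_ ?_
  · intro κ hκ κ' hκ' hκκ
    obtain ⟨z, hz, rfl⟩ := Finset.mem_image.1 hκ
    obtain ⟨z', hz', rfl⟩ := Finset.mem_image.1 hκ'
    have hzz : z ≠ z' := fun h => hκκ (h ▸ rfl)
    rcases hC hz hz' hzz with h | h
    · exact Or.inl (hlt z hz z' hz' hzz h)
    · exact Or.inr (hlt z' hz' z hz hzz.symm h)
  · intro κ hκ
    obtain ⟨z, hz, rfl⟩ := Finset.mem_image.1 hκ
    exact mem_occupiedCells.2 ⟨z, hCA hz, hr z hz⟩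

lemma finite_of_gridSlab_subsingleton (hd : 0 < d) (hab : ∀ i, a i < b i) (hm : 0 < m)
    {A : Set (Fin d → ℝ)} (hA : A ⊆ halfOpenBox a b)
    (hslab : ∀ i j, (A ∩ gridSlab a b m i j).Subsingleton) : A.Finite := by
  refine (Set.finite_iUnion fun j => (hslab ⟨0, hd⟩ j).finite).subset fun z hz => ?_
  obtain ⟨κ, hκ⟩ := exists_mem_gridCell hab hm (hA hz)
  exact mem_iUnion.2 ⟨κ ⟨0, hd⟩, hz, gridCell_subset_gridSlab hab κ _ hκ⟩

end grid

section poissonWeight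

/-- The Poisson probability mass function with mean `r`. -/
def poissonWeight (r : ℝ) (N : ℕ) : ℝ := Real.exp (-r) * r ^ N / N.factorial

lemma poissonWeight_nonneg {r : ℝ} (hr : 0 ≤ r) (N : ℕ) : 0 ≤ poissonWeight r N := by
  unfold poissonWeight; positivity

lemma hasSum_poissonWeight_mul_pow (r y : ℝ) :
    HasSum (fun N => poissonWeight r N * y ^ N) (Real.exp (r * y - r)) := by
  have h := (NormedSpace.expSeries_div_hasSum_exp (r * y)).mul_left (Real.exp (-r))
  rw [← Real.exp_eq_exp_ℝ, ← Real.exp_add, neg_add_eq_sub] at h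
  refine h.congr_fun fun N => ?_
  rw [poissonWeight, mul_pow]; ring

lemma hasSum_poissonWeight (r : ℝ) : HasSum (poissonWeight r) 1 := by
  simpa using hasSum_poissonWeight_mul_pow r 1

lemma hasSum_poissonWeight_mul_natCast {r s : ℝ} {f : ℕ → ℝ}
    (hf : HasSum (fun N => poissonWeight r N * f (N + 1)) s) :
    HasSum (fun N => poissonWeight r N * (N * f N)) (r * s) := by
  rw [← hasSum_nat_add_iff' 1]
  simp only [Finset.range_one, Finset.sum_singleton, Nat.cast_zero, zero_mul, mul_zero, sub_zero]
  refine (hf.mul_left r).congr_fun fun N => ?_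
  rw [poissonWeight, poissonWeight, Nat.factorial_succ]
  push_cast
  field_simp
  ring

lemma hasSum_poissonWeight_mean (r : ℝ) : HasSum (fun N => poissonWeight r N * N) r := by
  have h := hasSum_poissonWeight_mul_natCast (r := r) (f := fun _ => 1)
    (by simpa using hasSum_poissonWeight r)
  simpa using h

lemma hasSum_poissonWeight_sq (r : ℝ) :
    HasSum (fun N => poissonWeight r N * (N : ℝ) ^ 2) (r * (r + 1)) := by
  have h := hasSum_poissonWeight_mul_natCast (r := r) (f := fun N => N)
    (((hasSum_poissonWeight_mean r).add (hasSum_poissonWeight r)).congr_fun fun N => by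
      push_cast; ring)
  exact h.congr_fun fun N => by ring

lemma exists_hasSum_poissonWeight_cube (r : ℝ) :
    ∃ s, HasSum (fun N => poissonWeight r N * (N : ℝ) ^ 3) s := by
  have h := hasSum_poissonWeight_mul_natCast (r := r) (f := fun N => (N : ℝ) ^ 2)
    (((hasSum_poissonWeight_sq r).add (((hasSum_poissonWeight_mean r).mul_left 2).add
      (hasSum_poissonWeight r))).congr_fun fun N => by push_cast; ring)
  exact ⟨_, h.congr_fun fun N => by ring⟩

lemma hasSum_poissonWeight_quadratic {r : ℝ} (α β γ : ℝ) :
    HasSum (fun N => poissonWeight r N * (α + β * N + γ * (N : ℝ) ^ 2))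
      (α + β * r + γ * (r * (r + 1))) := by
  have h := (((hasSum_poissonWeight r).mul_left α).add
    ((hasSum_poissonWeight_mean r).mul_left β)).add ((hasSum_poissonWeight_sq r).mul_left γ)
  rw [mul_one] at h
  exact h.congr_fun fun N => by ring

end poissonWeight

section rootBounds

lemma rpow_le_tangent {x r q : ℝ} (hx : 0 ≤ x) (hr : 0 < r) (hq0 : 0 ≤ q) (hq1 : q ≤ 1) :
    x ^ q ≤ r ^ q * (1 + q * (x / r - 1)) := by
  have h := rpow_one_add_le_one_add_mul_self (s := x / r - 1)
    (by linarith [div_nonneg hx hr.le]) hq0 hq1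
  rw [add_sub_cancel, Real.div_rpow hx hr.le, div_le_iff₀ (Real.rpow_pos_of_pos hr q)] at h
  linarith

lemma rpow_mul_le_rpow {x r q δ : ℝ} (hx : 0 ≤ x) (hr : 0 < r) (hq0 : 0 < q) (hq1 : q ≤ 1)
    (hδ : 0 < δ) : r ^ q * (1 - δ - (x / r - 1) ^ 2 / (4 * δ)) ≤ x ^ q := by
  have hx' : x ^ q = r ^ q * (x / r) ^ q := by
    rw [← Real.mul_rpow hr.le (div_nonneg hx hr.le), mul_div_cancel₀ _ hr.ne']
  rw [hx']
  refine mul_le_mul_of_nonneg_left ?_ (Real.rpow_nonneg hr.le q)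
  set y := x / r
  have hy : 0 ≤ y := div_nonneg hx hr.le
  have habs : |y - 1| ≤ δ + (y - 1) ^ 2 / (4 * δ) := by
    rw [← sq_abs (y - 1), ← sub_nonneg]
    have : δ + |y - 1| ^ 2 / (4 * δ) - |y - 1| = (2 * δ - |y - 1|) ^ 2 / (4 * δ) := by
      field_simp; ring
    rw [this]; positivity
  rcases le_total y 1 with h | h
  · have h1 : y ≤ y ^ q := by
      simpa using Real.rpow_le_rpow_of_exponent_ge' hy h hq0.le hq1
    rw [abs_of_nonpos (by linarith)] at habs
    linarith
  · have h1 : 1 ≤ y ^ q := Real.one_le_rpow h hq0.le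
    rw [abs_of_nonneg (by linarith)] at habs
    linarith

end rootBounds

section uniformPoints

variable {d : ℕ}

/-- The law of `N` independent uniform points of the unit cube. -/
abbrev uniformPoints (d N : ℕ) : Measure (Fin N → Fin d → ℝ) :=
  Measure.pi fun _ => volume.restrict (Icc (0 : Fin d → ℝ) 1)

instance : IsProbabilityMeasure ((volume : Measure (Fin d → ℝ)).restrict (Icc 0 1)) := by
  constructor
  rw [Measure.restrict_apply_univ, Real.volume_Icc_pi]
  simp

/-- The set of grid cells of the unit cube occupied by the points `X`. -/
abbrev unitOccupied (m : ℕ) {N : ℕ} (X : Fin N → Fin d → ℝ) : Finset (Fin d → Fin m) :=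
  occupiedCells (0 : Fin d → ℝ) 1 m (range X)

lemma measureReal_restrict_unitCube {A : Set (Fin d → ℝ)} (hA : A ⊆ halfOpenBox 0 1) :
    (volume.restrict (Icc (0 : Fin d → ℝ) 1)).real A = volume.real A := by
  rw [measureReal_def, measureReal_def,
    Measure.restrict_eq_self _ (hA.trans (halfOpenBox_subset_Icc _ _))]

lemma measurableSet_mem_unitOccupied {m N : ℕ} (κ : Fin d → Fin m) :
    MeasurableSet {X : Fin N → Fin d → ℝ | κ ∈ unitOccupied m X} := by
  have : {X : Fin N → Fin d → ℝ | κ ∈ unitOccupied m X} =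
      ⋃ j, (fun X : Fin N → Fin d → ℝ => X j) ⁻¹' gridCell 0 1 m κ := by
    ext X
    simp only [mem_ofPred_eq, mem_occupiedCells, mem_iUnion, mem_preimage]
    constructor
    · rintro ⟨_, ⟨j, rfl⟩, h⟩; exact ⟨j, h⟩
    · rintro ⟨j, h⟩; exact ⟨X j, ⟨j, rfl⟩, h⟩
  rw [this]
  exact MeasurableSet.iUnion fun j => measurable_pi_apply j (measurableSet_gridCell κ)

lemma measureReal_unitOccupied_subset {m : ℕ} (hm : 0 < m) (N : ℕ)
    (T : Finset (Fin d → Fin m)) :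
    (uniformPoints d N).real {X | unitOccupied m X ⊆ T} = ((T.card : ℝ) / (m : ℝ) ^ d) ^ N := by
  have hlt : ∀ i : Fin d, (0 : Fin d → ℝ) i < (1 : Fin d → ℝ) i := fun i => by simp
  set V : Set (Fin d → ℝ) := ⋃ κ ∈ Tᶜ, gridCell 0 1 m κ with hV
  have hset : {X : Fin N → Fin d → ℝ | unitOccupied m X ⊆ T} = Set.pi univ fun _ => Vᶜ := by
    ext X
    simp only [mem_ofPred_eq, Set.mem_pi, mem_univ, true_imp_iff, hV, mem_compl_iff, mem_iUnion,
      not_exists, Finset.mem_compl]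
    constructor
    · intro h j κ hκ hj
      exact hκ (h (mem_occupiedCells.2 ⟨X j, ⟨j, rfl⟩, hj⟩))
    · intro h κ hκ
      obtain ⟨_, ⟨j, rfl⟩, hj⟩ := mem_occupiedCells.1 hκ
      by_contra hT
      exact h j κ hT hj
  have hmeas : MeasurableSet V := Finset.measurableSet_biUnion _ fun κ _ => measurableSet_gridCell κ
  have hVsub : V ⊆ halfOpenBox 0 1 := iUnion₂_subset fun κ _ => gridCell_subset hlt κ
  have hvol : volume.real V = (Tᶜ.card : ℝ) / (m : ℝ) ^ d := by
    have hfin : ∀ κ ∈ Tᶜ, volume (gridCell (0 : Fin d → ℝ) 1 m κ) ≠ ⊤ := fun κ _ =>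
      (isBounded_halfOpenBox _ _).measure_lt_top.ne
    rw [hV, measureReal_biUnion_finset (fun κ _ κ' _ hne => disjoint_gridCell hlt hne)
      (fun κ _ => measurableSet_gridCell κ) hfin]
    simp [volume_gridCell hlt, div_eq_mul_inv]
  have hν : (volume.restrict (Icc (0 : Fin d → ℝ) 1)).real Vᶜ = (T.card : ℝ) / (m : ℝ) ^ d := by
    rw [probReal_compl_eq_one_sub hmeas, measureReal_restrict_unitCube hVsub, hvol,
      Finset.card_compl, Nat.cast_sub (Finset.card_le_univ T)]
    have : (m : ℝ) ≠ 0 := by exact_mod_cast hm.ne'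
    simp only [Fintype.card_pi, Fintype.card_fin, Finset.prod_const, Finset.card_univ, Nat.cast_pow]
    field_simp
    ring
  rw [hset, measureReal_def, Measure.pi_pi, ENNReal.toReal_prod, Finset.prod_const,
    Finset.card_univ, Fintype.card_fin, ← measureReal_def, hν]

/-- The expected length of the longest chain of grid cells occupied by `N` uniform points. -/
def uniformCellMean (d m N : ℕ) : ℝ :=
  ∫ X, (cellChainLength m (unitOccupied m X) : ℝ) ∂uniformPoints d N

/-- The expected length of the longest chain of occupied grid cells when each cell is occupied
independently, with the probability given by a Poisson process of total mass `r`. -/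
def poissonCellMean (d m : ℕ) (r : ℝ) : ℝ :=
  bernoulliExp (fun _ => 1 - Real.exp (-(r / (m : ℝ) ^ d))) Finset.univ
    fun S : Finset (Fin d → Fin m) => (cellChainLength m S : ℝ)

/-- Poissonization. -/
lemma hasSum_poissonWeight_uniformCellMean {m : ℕ} (hm : 0 < m) {r : ℝ} (hr : 0 ≤ r) :
    HasSum (fun N => poissonWeight r N * uniformCellMean d m N) (poissonCellMean d m r) := by
  have hm' : (m : ℝ) ≠ 0 := by exact_mod_cast hm.ne'
  have hocc : ∀ N, ∀ κ, MeasurableSet {X : Fin N → Fin d → ℝ | κ ∈ unitOccupied m X} :=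
    fun N κ => measurableSet_mem_unitOccupied κ
  have hsummable : ∀ S : Finset (Fin d → Fin m), Summable fun N =>
      poissonWeight r N * (uniformPoints d N).real {X | unitOccupied m X = S} := fun S =>
    (hasSum_poissonWeight r).summable.of_nonneg_of_le
      (fun N => mul_nonneg (poissonWeight_nonneg hr N) measureReal_nonneg)
      (fun N => mul_le_of_le_one_right (poissonWeight_nonneg hr N) measureReal_le_one)
  rw [poissonCellMean, ← sum_mul_eq_bernoulliExp (q := fun S => ∑' N,
    poissonWeight r N * (uniformPoints d N).real {X | unitOccupied m X = S})]
  · refine (hasSum_sum fun S _ => (hsummable S).hasSum.mul_right _).congr_fun fun N => ?_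
    rw [uniformCellMean, (sum_mul_eq_integral (hocc N) fun S => (cellChainLength m S : ℝ)).2,
      Finset.mul_sum]
    exact Finset.sum_congr rfl fun S _ => by ring
  · intro T
    refine HasSum.unique (hasSum_sum fun S _ => (hsummable S).hasSum) ?_
    have h := hasSum_poissonWeight_mul_pow r ((T.card : ℝ) / (m : ℝ) ^ d)
    have hval : Real.exp (r * ((T.card : ℝ) / (m : ℝ) ^ d) - r) =
        ∏ _k ∈ Tᶜ, (1 - (1 - Real.exp (-(r / (m : ℝ) ^ d)))) := by
      rw [Finset.prod_const, sub_sub_cancel, ← Real.exp_nat_mul, Finset.card_compl,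
        Nat.cast_sub (Finset.card_le_univ T)]
      simp only [Fintype.card_pi, Fintype.card_fin, Finset.prod_const, Finset.card_univ,
        Nat.cast_pow]
      congr 1
      field_simp
      ring
    rw [← hval]
    refine h.congr_fun fun N => ?_
    rw [← Finset.mul_sum, ← measureReal_occ_mem (hocc N), ← measureReal_unitOccupied_subset hm]
    simp

end uniformPoints

section uniformPoints

variable {d : ℕ}

lemma unit_lt (i : Fin d) : (0 : Fin d → ℝ) i < (1 : Fin d → ℝ) i := by simp

lemma chainLength_range_le {N : ℕ} (X : Fin N → Fin d → ℝ) : chainLength d (range X) ≤ N := by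
  classical
  refine chainLength_le fun C hC _ => ?_
  have : C ⊆ Finset.univ.image X := fun z hz => by simpa using hC hz
  simpa using (Finset.card_le_card this).trans Finset.card_image_le

lemma integrable_cellChainLength (m N : ℕ) :
    Integrable (fun X => (cellChainLength m (unitOccupied m X) : ℝ)) (uniformPoints d N) :=
  (sum_mul_eq_integral (fun κ => measurableSet_mem_unitOccupied κ)
    fun S => (cellChainLength m S : ℝ)).1

lemma integrable_chainLength {N : ℕ} (h : BWexpect d N ≠ 0) :
    Integrable (fun X => (chainLength d (range X) : ℝ)) (uniformPoints d N) := by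
  by_contra hintg
  exact h (integral_undef hintg)

lemma cellChainLength_le_range (m : ℕ) {N : ℕ} (X : Fin N → Fin d → ℝ) :
    cellChainLength m (unitOccupied m X) ≤ chainLength d (range X) :=
  cellChainLength_le_chainLength unit_lt (finite_range X)

lemma uniformCellMean_le_natCast (m N : ℕ) : uniformCellMean d m N ≤ N := by
  have h : uniformCellMean d m N ≤ ∫ _, (N : ℝ) ∂uniformPoints d N :=
    integral_mono (integrable_cellChainLength m N) (integrable_const _) fun X =>
      Nat.cast_le.2 ((cellChainLength_le_range m X).trans (chainLength_range_le X))
  simpa using h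

lemma uniformCellMean_nonneg (m N : ℕ) : 0 ≤ uniformCellMean d m N :=
  integral_nonneg fun _ => Nat.cast_nonneg _

lemma uniformCellMean_le_BWexpect {N : ℕ} (h : BWexpect d N ≠ 0) (m : ℕ) :
    uniformCellMean d m N ≤ BWexpect d N :=
  integral_mono (integrable_cellChainLength m N) (integrable_chainLength h) fun X =>
    Nat.cast_le.2 (cellChainLength_le_range m X)

/-- The event that two of the points with different labels lie in a common slab. -/
def slabCollision (d m N : ℕ) (t : Fin N × Fin N × Fin d × Fin m) : Set (Fin N → Fin d → ℝ) :=
  {X | t.1 ≠ t.2.1 ∧ X t.1 ∈ gridSlab 0 1 m t.2.2.1 t.2.2.2 ∧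
    X t.2.1 ∈ gridSlab 0 1 m t.2.2.1 t.2.2.2}

lemma measurableSet_slabCollision (m N : ℕ) (t : Fin N × Fin N × Fin d × Fin m) :
    MeasurableSet (slabCollision d m N t) := by
  have h : slabCollision d m N t = {_X | t.1 ≠ t.2.1} ∩
      ((fun X => X t.1) ⁻¹' gridSlab 0 1 m t.2.2.1 t.2.2.2 ∩
        (fun X => X t.2.1) ⁻¹' gridSlab 0 1 m t.2.2.1 t.2.2.2) := rfl
  rw [h]
  exact (MeasurableSet.const _).inter
    ((measurable_pi_apply t.1 (measurableSet_halfOpenBox _ _)).inter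
      (measurable_pi_apply t.2.1 (measurableSet_halfOpenBox _ _)))

lemma measureReal_slabCollision_le (m N : ℕ) (t : Fin N × Fin N × Fin d × Fin m) :
    (uniformPoints d N).real (slabCollision d m N t) ≤ (1 / (m : ℝ)) ^ 2 := by
  classical
  obtain ⟨j, j', i, s⟩ := t
  rcases eq_or_ne j j' with rfl | hne
  · have : slabCollision d m N (j, j, i, s) = ∅ := by simp [slabCollision]
    rw [this, measureReal_empty]; positivity
  · have hset : slabCollision d m N (j, j', i, s) = Set.pi univ fun k =>
        if k ∈ ({j, j'} : Finset (Fin N)) then gridSlab 0 1 m i s else univ := by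
      ext X
      simp only [slabCollision, mem_ofPred_eq, Set.mem_pi, mem_univ, true_imp_iff]
      constructor
      · rintro ⟨-, h1, h2⟩ k
        split_ifs with hk
        · rcases Finset.mem_insert.1 hk with rfl | hk
          · exact h1
          · rw [Finset.mem_singleton.1 hk]; exact h2
        · trivial
      · intro h
        exact ⟨hne, by simpa using h j, by simpa using h j'⟩
    have hprod : ∀ k : Fin N, (volume.restrict (Icc (0 : Fin d → ℝ) 1)).real
        (if k ∈ ({j, j'} : Finset (Fin N)) then gridSlab 0 1 m i s else univ) =
        if k ∈ ({j, j'} : Finset (Fin N)) then 1 / (m : ℝ) else 1 := by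
      intro k
      split_ifs
      · rw [measureReal_restrict_unitCube (gridSlab_subset unit_lt i s), volume_gridSlab unit_lt]
        simp
      · exact probReal_univ
    rw [hset, measureReal_def, Measure.pi_pi, ENNReal.toReal_prod]
    simp only [← measureReal_def, hprod]
    rw [Finset.prod_ite_mem, Finset.univ_inter, Finset.prod_const, Finset.card_pair hne]

lemma BWexpect_le_uniformCellMean {m N : ℕ} (hm : 0 < m) (h : BWexpect d N ≠ 0) :
    BWexpect d N ≤ uniformCellMean d m N + d / m * (N : ℝ) ^ 3 := by
  have hm' : (m : ℝ) ≠ 0 := by exact_mod_cast hm.ne'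
  set O : Set (Fin N → Fin d → ℝ) := ⋃ j, (fun X => X j) ⁻¹' (halfOpenBox 0 1)ᶜ with hO
  set D : Set (Fin N → Fin d → ℝ) := ⋃ t, slabCollision d m N t with hD
  have hOmeas : MeasurableSet O := MeasurableSet.iUnion fun j =>
    measurable_pi_apply j (measurableSet_halfOpenBox _ _).compl
  have hDmeas : MeasurableSet D := MeasurableSet.iUnion fun t => measurableSet_slabCollision m N t
  have hOzero : (uniformPoints d N).real O = 0 := by
    rw [measureReal_def, hO, measure_iUnion_null fun j => ?_, ENNReal.toReal_zero]
    have hbox : (volume.restrict (Icc (0 : Fin d → ℝ) 1)) (halfOpenBox 0 1)ᶜ = 0 := by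
      rw [prob_compl_eq_zero_iff (measurableSet_halfOpenBox _ _),
        Measure.restrict_eq_self _ (halfOpenBox_subset_Icc _ _), halfOpenBox, Real.volume_pi_Ico]
      simp
    rw [(measurePreserving_eval (fun _ : Fin N => volume.restrict (Icc (0 : Fin d → ℝ) 1))
      j).measure_preimage (measurableSet_halfOpenBox _ _).compl.nullMeasurableSet, hbox]
  have hDle : (uniformPoints d N).real D ≤ d / m * (N : ℝ) ^ 2 := by
    refine (measureReal_iUnion_fintype_le _).trans ?_
    refine (Finset.sum_le_sum fun t _ => measureReal_slabCollision_le m N t).trans_eq ?_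
    simp only [Finset.sum_const, Finset.card_univ, Fintype.card_prod, Fintype.card_fin,
      nsmul_eq_mul, Nat.cast_mul]
    field_simp
  have hle : ∀ X : Fin N → Fin d → ℝ, (chainLength d (range X) : ℝ) ≤
      cellChainLength m (unitOccupied m X) + (O ∪ D).indicator (fun _ => (N : ℝ)) X := by
    intro X
    by_cases hX : X ∈ O ∪ D
    · rw [Set.indicator_of_mem hX]
      have : (chainLength d (range X) : ℝ) ≤ N := by exact_mod_cast chainLength_range_le X
      have : (0 : ℝ) ≤ cellChainLength m (unitOccupied m X) := Nat.cast_nonneg _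
      linarith
    · rw [Set.indicator_of_notMem hX, add_zero]
      simp only [hO, hD, mem_union, mem_iUnion, mem_preimage, mem_compl_iff, not_or, not_exists,
        not_not] at hX
      refine mod_cast chainLength_le_cellChainLength unit_lt hm ?_ ?_
      · rintro _ ⟨j, rfl⟩; exact hX.1 j
      · rintro i s _ ⟨⟨j, rfl⟩, hj⟩ _ ⟨⟨j', rfl⟩, hj'⟩
        by_contra hne
        exact hX.2 (j, j', i, s) ⟨fun h => hne (congrArg X h), hj, hj'⟩
  have hind : Integrable ((O ∪ D).indicator fun _ => (N : ℝ)) (uniformPoints d N) :=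
    (integrable_const _).indicator (hOmeas.union hDmeas)
  have hmain : BWexpect d N ≤ uniformCellMean d m N +
      (uniformPoints d N).real (O ∪ D) * N := by
    refine (integral_mono (integrable_chainLength h)
      ((integrable_cellChainLength m N).add hind) hle).trans_eq ?_
    rw [integral_add' (integrable_cellChainLength m N) hind,
      integral_indicator_const _ (hOmeas.union hDmeas), smul_eq_mul]
    rfl
  have hunion := measureReal_union_le (μ := uniformPoints d N) O D
  have : (uniformPoints d N).real (O ∪ D) * N ≤ d / m * (N : ℝ) ^ 2 * N :=
    mul_le_mul_of_nonneg_right (by linarith) (Nat.cast_nonneg N)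
  linarith [pow_succ (N : ℝ) 2]

end uniformPoints

section poissonCellMean

variable {d : ℕ} {c : ℝ}

/-- Two-sided bounds for the expected chain length valid for all large numbers of points. -/
lemma IsBWConstant.eventually_bounds (hc : IsBWConstant d c) {ε : ℝ} (hε : 0 < ε) :
    ∃ N₀ : ℕ, ∀ N ≥ N₀, BWexpect d N ≠ 0 ∧
      (c - ε) * (N : ℝ) ^ ((1 : ℝ) / d) ≤ BWexpect d N ∧
      BWexpect d N ≤ (c + ε) * (N : ℝ) ^ ((1 : ℝ) / d) := by
  have h1 := hc.2.eventually (Ioo_mem_nhds (sub_lt_self c hε) (lt_add_of_pos_right c hε))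
  have h2 := hc.2.eventually (lt_mem_nhds hc.1)
  obtain ⟨N₀, hN₀⟩ := eventually_atTop.1 ((h1.and h2).and (eventually_ge_atTop 1))
  refine ⟨N₀, fun N hN => ?_⟩
  obtain ⟨⟨⟨hlo, hhi⟩, hpos⟩, hN1⟩ := hN₀ N hN
  have hN' : (0 : ℝ) < N := by exact_mod_cast hN1
  have hr : 0 < (N : ℝ) ^ ((1 : ℝ) / d) := Real.rpow_pos_of_pos hN' _
  rw [neg_div, Real.rpow_neg hN'.le, inv_mul_eq_div] at hlo hhi hpos
  rw [lt_div_iff₀ hr] at hlo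
  rw [div_lt_iff₀ hr] at hhi
  refine ⟨?_, hlo.le, hhi.le⟩
  rintro h0
  simp [h0] at hpos

lemma one_div_natCast_mem (hd : 0 < d) : 0 < (1 : ℝ) / d ∧ (1 : ℝ) / d ≤ 1 := by
  have : (1 : ℝ) ≤ d := by exact_mod_cast hd
  exact ⟨by positivity, by rw [div_le_one (by linarith)]; exact this⟩

lemma poissonCellMean_le (hd : 0 < d) (hc : IsBWConstant d c) {ε : ℝ} (hε : 0 < ε) :
    ∀ᶠ r : ℝ in atTop, ∀ m : ℕ, 0 < m →
      poissonCellMean d m r ≤ (c + ε) * r ^ ((1 : ℝ) / d) := by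
  obtain ⟨N₀, hN₀⟩ := hc.eventually_bounds (half_pos hε)
  obtain ⟨hq0, hq1⟩ := one_div_natCast_mem hd
  have hbig : ∀ᶠ r : ℝ in atTop, N₀ ≤ ε / 2 * r ^ ((1 : ℝ) / d) :=
    ((tendsto_rpow_atTop hq0).const_mul_atTop (half_pos hε)).eventually_ge_atTop _
  filter_upwards [hbig, eventually_gt_atTop 0] with r hrbig hr m hm
  set q := (1 : ℝ) / d
  have hcε : 0 ≤ c + ε / 2 := by linarith [hc.1]
  have hN : ∀ N : ℕ, uniformCellMean d m N ≤
      ((c + ε / 2) * r ^ q * (1 - q) + N₀) + ((c + ε / 2) * r ^ q * q / r) * N +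
        0 * (N : ℝ) ^ 2 := by
    intro N
    have htan := mul_le_mul_of_nonneg_left
      (rpow_le_tangent (x := N) (Nat.cast_nonneg N) hr hq0.le hq1) hcε
    have hlow : uniformCellMean d m N ≤ (c + ε / 2) * (N : ℝ) ^ q + N₀ := by
      rcases le_total N₀ N with hle | hle
      · have := uniformCellMean_le_BWexpect (hN₀ N hle).1 m
        have := (hN₀ N hle).2.2
        have : (0 : ℝ) ≤ N₀ := Nat.cast_nonneg _
        linarith
      · have := uniformCellMean_le_natCast (d := d) m N
        have : (N : ℝ) ≤ N₀ := by exact_mod_cast hle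
        have : 0 ≤ (c + ε / 2) * (N : ℝ) ^ q := by positivity
        linarith
    have heq : (c + ε / 2) * (r ^ q * (1 + q * (N / r - 1))) =
        (c + ε / 2) * r ^ q * (1 - q) + ((c + ε / 2) * r ^ q * q / r) * N := by ring
    linarith
  have h := hasSum_le (fun N => mul_le_mul_of_nonneg_left (hN N) (poissonWeight_nonneg hr.le N))
    (hasSum_poissonWeight_uniformCellMean hm hr.le) (hasSum_poissonWeight_quadratic _ _ _)
  have heq : ((c + ε / 2) * r ^ q * (1 - q) + N₀) + ((c + ε / 2) * r ^ q * q / r) * r +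
      0 * (r * (r + 1)) = (c + ε / 2) * r ^ q + N₀ := by field_simp; ring
  rw [heq] at h
  linarith

lemma le_poissonCellMean (hd : 0 < d) (hc : IsBWConstant d c) {ε : ℝ} (hε : 0 < ε) :
    ∀ᶠ r : ℝ in atTop, ∀ᶠ m : ℕ in atTop,
      (c - ε) * r ^ ((1 : ℝ) / d) ≤ poissonCellMean d m r := by
  obtain ⟨hq0, hq1⟩ := one_div_natCast_mem hd
  rcases le_or_gt c ε with hcε | hcε
  · filter_upwards [eventually_ge_atTop 0] with r hr
    filter_upwards [eventually_gt_atTop 0] with m hm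
    have h := (hasSum_poissonWeight_uniformCellMean (d := d) hm hr).nonneg fun N =>
      mul_nonneg (poissonWeight_nonneg hr N) (uniformCellMean_nonneg m N)
    exact (mul_nonpos_of_nonpos_of_nonneg (by linarith) (Real.rpow_nonneg hr _)).trans h
  obtain ⟨N₀, hN₀⟩ := hc.eventually_bounds (half_pos hε)
  set q := (1 : ℝ) / d
  set a := c - ε / 2 with ha_def
  have ha : 0 < a := by linarith
  set C := a * (N₀ : ℝ) ^ q with hC
  set δ := ε / (8 * a) with hδ_def
  have hδ : 0 < δ := by positivity
  have hC0 : 0 ≤ C := by positivity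
  have hbig : ∀ᶠ r : ℝ in atTop, C ≤ ε / 8 * r ^ q :=
    ((tendsto_rpow_atTop hq0).const_mul_atTop (by positivity)).eventually_ge_atTop _
  filter_upwards [hbig, eventually_gt_atTop 0, eventually_ge_atTop (16 * a ^ 2 / ε ^ 2)]
    with r hrbig hr hr2
  obtain ⟨s, hs⟩ := exists_hasSum_poissonWeight_cube r
  have hrq : 0 < r ^ q := Real.rpow_pos_of_pos hr q
  have hlim : Tendsto (fun m : ℕ => (d : ℝ) / m * s) atTop (𝓝 0) := by
    simpa using (tendsto_const_div_atTop_nhds_zero_nat (d : ℝ)).mul_const s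
  filter_upwards [hlim.eventually (ge_mem_nhds (show 0 < ε / 8 * r ^ q by positivity)),
    eventually_gt_atTop 0] with m hms hm
  set K := a * r ^ q with hK
  have hN : ∀ N : ℕ, (K * (1 - δ - 1 / (4 * δ)) - C) + K * (2 / r) / (4 * δ) * N +
      -(K / (4 * δ * r ^ 2)) * (N : ℝ) ^ 2 ≤ uniformCellMean d m N + d / m * (N : ℝ) ^ 3 := by
    intro N
    have hpow := mul_le_mul_of_nonneg_left
      (rpow_mul_le_rpow (x := N) (Nat.cast_nonneg N) hr hq0 hq1 hδ) ha.le
    have heq : (K * (1 - δ - 1 / (4 * δ)) - C) + K * (2 / r) / (4 * δ) * N +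
        -(K / (4 * δ * r ^ 2)) * (N : ℝ) ^ 2 =
        a * (r ^ q * (1 - δ - (N / r - 1) ^ 2 / (4 * δ))) - C := by
      rw [hK]; field_simp; ring
    have hlow : a * (N : ℝ) ^ q - C ≤ uniformCellMean d m N + d / m * (N : ℝ) ^ 3 := by
      rcases le_total N₀ N with hle | hle
      · have := BWexpect_le_uniformCellMean hm (hN₀ N hle).1
        have := (hN₀ N hle).2.1
        linarith
      · have h1 : a * (N : ℝ) ^ q ≤ C := mul_le_mul_of_nonneg_left
          (Real.rpow_le_rpow (Nat.cast_nonneg N) (by exact_mod_cast hle) hq0.le) ha.le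
        have h2 := uniformCellMean_nonneg (d := d) m N
        have h3 : 0 ≤ d / m * (N : ℝ) ^ 3 := by positivity
        linarith
    linarith
  have h := hasSum_le (fun N => mul_le_mul_of_nonneg_left (hN N) (poissonWeight_nonneg hr.le N))
    (hasSum_poissonWeight_quadratic _ _ _)
    (((hasSum_poissonWeight_uniformCellMean hm hr.le).add (hs.mul_left ((d : ℝ) / m))).congr_fun
      fun N => by ring)
  have heq : (K * (1 - δ - 1 / (4 * δ)) - C) + K * (2 / r) / (4 * δ) * r +
      -(K / (4 * δ * r ^ 2)) * (r * (r + 1)) = a * r ^ q - a * δ * r ^ q -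
        a / (4 * δ * r) * r ^ q - C := by
    rw [hK]; field_simp; ring
  rw [heq] at h
  have h1 : a * δ = ε / 8 := by rw [hδ_def]; field_simp
  have h2 : a / (4 * δ * r) ≤ ε / 8 := by
    rw [hδ_def, div_le_div_iff₀ (by positivity) (by norm_num)]
    rw [div_le_iff₀ (by positivity)] at hr2
    have : ε * (4 * (ε / (8 * a)) * r) = r * ε ^ 2 / (2 * a) := by field_simp; ring
    rw [this, le_div_iff₀ (by positivity)]
    linarith
  have h3 := mul_le_mul_of_nonneg_right h2 hrq.le
  rw [h1] at h
  have h4 : (c - ε) * r ^ q = a * r ^ q - ε / 2 * r ^ q := by rw [ha_def]; ring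
  linarith

end poissonCellMean

section poissonProcess

variable {d : ℕ} {Ω : Type*} [MeasurableSpace Ω] {P : Measure Ω} {g : (Fin d → ℝ) → ℝ}
  {a b : Fin d → ℝ} {m : ℕ}

lemma PoissonPP.measureReal_count_eq (X : PoissonPP d P g) {A : Set (Fin d → ℝ)}
    (hA : MeasurableSet A) (hAb : Bornology.IsBounded A) (hg : ∀ z, 0 ≤ g z) (k : ℕ) :
    P.real {ω | (X.pts ω ∩ A).encard = k} = poissonWeight (∫ z in A, g z) k := by
  rw [measureReal_def, X.poisson A hA hAb k, ENNReal.toReal_ofReal]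
  · rfl
  · exact poissonWeight_nonneg (integral_nonneg hg) k

variable (a b m) in
/-- The cells of the grid on `halfOpenBox a b` occupied by a point process. -/
def PoissonPP.occupied (X : PoissonPP d P g) (ω : Ω) : Finset (Fin d → Fin m) :=
  occupiedCells a b m (X.pts ω ∩ halfOpenBox a b)

lemma PoissonPP.mem_occupied (X : PoissonPP d P g) (hab : ∀ i, a i < b i) {ω : Ω}
    {κ : Fin d → Fin m} : κ ∈ X.occupied a b m ω ↔ (X.pts ω ∩ gridCell a b m κ).Nonempty := by
  rw [PoissonPP.occupied, mem_occupiedCells, inter_assoc,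
    inter_eq_right.2 (gridCell_subset hab κ)]

lemma isBounded_gridCell (hab : ∀ i, a i < b i) (κ : Fin d → Fin m) :
    Bornology.IsBounded (gridCell a b m κ) :=
  (isBounded_halfOpenBox a b).subset (gridCell_subset hab κ)

lemma PoissonPP.measurableSet_mem_occupied (X : PoissonPP d P g) (hab : ∀ i, a i < b i)
    (κ : Fin d → Fin m) : MeasurableSet {ω | κ ∈ X.occupied a b m ω} := by
  have h := (X.measur _ (measurableSet_gridCell κ) (isBounded_gridCell hab κ) 0).compl
  convert h using 1
  ext ω
  simp [X.mem_occupied hab, nonempty_iff_ne_empty]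

/-- The probability that a Poisson process with intensity `g` meets the cell `κ`. -/
def cellProb (g : (Fin d → ℝ) → ℝ) (a b : Fin d → ℝ) (m : ℕ) (κ : Fin d → Fin m) : ℝ :=
  1 - Real.exp (-∫ z in gridCell a b m κ, g z)

lemma PoissonPP.measureReal_occupied_subset (X : PoissonPP d P g) (hab : ∀ i, a i < b i)
    (hg : ∀ z, 0 ≤ g z) (hintg : IntegrableOn g (halfOpenBox a b)) (T : Finset (Fin d → Fin m)) :
    P.real {ω | X.occupied a b m ω ⊆ T} = ∏ κ ∈ Tᶜ, (1 - cellProb g a b m κ) := by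
  set V : Set (Fin d → ℝ) := ⋃ κ ∈ Tᶜ, gridCell a b m κ with hV
  have hVsub : V ⊆ halfOpenBox a b := iUnion₂_subset fun κ _ => gridCell_subset hab κ
  have hVmeas : MeasurableSet V := Finset.measurableSet_biUnion _ fun κ _ =>
    measurableSet_gridCell κ
  have hset : {ω | X.occupied a b m ω ⊆ T} = {ω | (X.pts ω ∩ V).encard = (0 : ℕ)} := by
    ext ω
    simp only [mem_ofPred_eq, Nat.cast_zero, encard_eq_zero]
    constructor
    · intro h
      refine eq_empty_of_forall_notMem fun z hz => ?_
      obtain ⟨κ, hκ, hzκ⟩ := mem_iUnion₂.1 hz.2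
      exact Finset.mem_compl.1 hκ (h ((X.mem_occupied hab).2 ⟨z, hz.1, hzκ⟩))
    · intro h κ hκ
      by_contra hκT
      obtain ⟨z, hz, hzκ⟩ := (X.mem_occupied hab).1 hκ
      exact (h ▸ ⟨hz, mem_iUnion₂.2 ⟨κ, Finset.mem_compl.2 hκT, hzκ⟩⟩ : z ∈ (∅ : Set _))
  rw [hset, X.measureReal_count_eq hVmeas ((isBounded_halfOpenBox a b).subset hVsub) hg, hV,
    integral_biUnion_finset _ (fun κ _ => measurableSet_gridCell κ)
      (fun κ _ κ' _ hne => disjoint_gridCell hab hne)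
      (fun κ _ => hintg.mono_set (gridCell_subset hab κ))]
  simp [poissonWeight, cellProb, ← Finset.sum_neg_distrib, Real.exp_sum]

/-- The event that some slab of the grid contains at least two points of the process. -/
def PoissonPP.crowded (X : PoissonPP d P g) (a b : Fin d → ℝ) (m : ℕ) : Set Ω :=
  ⋃ t : Fin d × Fin m, ({ω | (X.pts ω ∩ gridSlab a b m t.1 t.2).encard = (0 : ℕ)} ∪
    {ω | (X.pts ω ∩ gridSlab a b m t.1 t.2).encard = (1 : ℕ)})ᶜ

lemma PoissonPP.subsingleton_of_notMem_crowded (X : PoissonPP d P g) {ω : Ω}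
    (h : ω ∉ X.crowded a b m) (i : Fin d) (j : Fin m) :
    (X.pts ω ∩ halfOpenBox a b ∩ gridSlab a b m i j).Subsingleton := by
  rw [PoissonPP.crowded, mem_iUnion, not_exists] at h
  have h := not_not.1 (h (i, j))
  refine Set.Subsingleton.anti (t := X.pts ω ∩ gridSlab a b m i j) ?_
    (inter_subset_inter_left _ inter_subset_left)
  rw [← encard_le_one_iff_subsingleton]
  rcases h with h | h
  · rw [mem_ofPred_eq] at h; simp [h]
  · rw [mem_ofPred_eq] at h; simp [h]

lemma PoissonPP.measure_crowded_le [IsProbabilityMeasure P] (X : PoissonPP d P g)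
    (hab : ∀ i, a i < b i) (hg : ∀ z, 0 ≤ g z) (hintg : IntegrableOn g (halfOpenBox a b)) {M : ℝ}
    (hM : ∀ z ∈ halfOpenBox a b, g z ≤ M) (hm : 0 < m) :
    P (X.crowded a b m) ≤ ENNReal.ofReal (d / m * (M * ∏ i, (b i - a i)) ^ 2) := by
  have hm' : (m : ℝ) ≠ 0 := by exact_mod_cast hm.ne'
  have hslab : ∀ i j, P.real ({ω | (X.pts ω ∩ gridSlab a b m i j).encard = (0 : ℕ)} ∪
      {ω | (X.pts ω ∩ gridSlab a b m i j).encard = (1 : ℕ)})ᶜ ≤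
      (M * ∏ i, (b i - a i)) ^ 2 / (m : ℝ) ^ 2 := by
    intro i j
    have hmeas : MeasurableSet (gridSlab a b m i j) := measurableSet_halfOpenBox _ _
    have hbdd : Bornology.IsBounded (gridSlab a b m i j) := isBounded_halfOpenBox _ _
    have hdisj : Disjoint {ω | (X.pts ω ∩ gridSlab a b m i j).encard = (0 : ℕ)}
        {ω | (X.pts ω ∩ gridSlab a b m i j).encard = (1 : ℕ)} := by
      refine Set.disjoint_left.2 fun ω h0 h1 => ?_
      rw [mem_ofPred_eq] at h0 h1
      rw [h0] at h1
      norm_num at h1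
    rw [probReal_compl_eq_one_sub
      ((X.measur _ hmeas hbdd 0).union (X.measur _ hmeas hbdd 1)),
      measureReal_union hdisj (X.measur _ hmeas hbdd 1), X.measureReal_count_eq hmeas hbdd hg,
      X.measureReal_count_eq hmeas hbdd hg]
    set μ := ∫ z in gridSlab a b m i j, g z with hμ
    have hμ0 : 0 ≤ μ := integral_nonneg hg
    have hμM : μ ≤ M * ((∏ i, (b i - a i)) / m) := by
      have h := setIntegral_mono_on (hintg.mono_set (gridSlab_subset hab i j))
        (integrableOn_const (hbdd.measure_lt_top.ne)) hmeas
        fun z hz => hM z (gridSlab_subset hab i j hz)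
      rw [setIntegral_const, volume_gridSlab hab, smul_eq_mul, mul_comm] at h
      exact h
    have hexp : 1 - μ ≤ Real.exp (-μ) := by linarith [Real.add_one_le_exp (-μ)]
    have h1 : 1 - (poissonWeight μ 0 + poissonWeight μ 1) ≤ μ ^ 2 := by
      simp only [poissonWeight, pow_zero, Nat.factorial_zero, Nat.factorial_one, pow_one,
        Nat.cast_one, div_one, mul_one]
      nlinarith
    refine h1.trans ((pow_le_pow_left₀ hμ0 hμM 2).trans_eq ?_)
    field_simp
  rw [← ofReal_measureReal]
  refine ENNReal.ofReal_le_ofReal ?_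
  refine (measureReal_iUnion_fintype_le _).trans ?_
  refine (Finset.sum_le_sum fun t _ => hslab t.1 t.2).trans_eq ?_
  simp only [Finset.sum_const, Finset.card_univ, Fintype.card_prod, Fintype.card_fin,
    nsmul_eq_mul, Nat.cast_mul]
  field_simp

lemma le_of_forall_le_add_div {x y : ENNReal} {K : ℝ}
    (h : ∀ᶠ m : ℕ in atTop, x ≤ y + ENNReal.ofReal (K / m)) : x ≤ y := by
  have hlim : Tendsto (fun m : ℕ => y + ENNReal.ofReal (K / m)) atTop (𝓝 y) := by
    have := (ENNReal.tendsto_ofReal (tendsto_const_div_atTop_nhds_zero_nat K))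
    simpa using this.const_add y
  exact ge_of_tendsto hlim h

lemma PoissonPP.ae_finite [IsProbabilityMeasure P] (hd : 0 < d) (X : PoissonPP d P g)
    (hab : ∀ i, a i < b i) (hg : ∀ z, 0 ≤ g z) (hintg : IntegrableOn g (halfOpenBox a b)) {M : ℝ}
    (hM : ∀ z ∈ halfOpenBox a b, g z ≤ M) : ∀ᵐ ω ∂P, (X.pts ω ∩ halfOpenBox a b).Finite := by
  rw [ae_iff, ← nonpos_iff_eq_zero]
  refine le_of_forall_le_add_div (K := d * (M * ∏ i, (b i - a i)) ^ 2) ?_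
  filter_upwards [eventually_gt_atTop 0] with m hm
  rw [zero_add, mul_div_right_comm]
  refine (measure_mono fun ω hω => ?_).trans (X.measure_crowded_le hab hg hintg hM hm)
  by_contra hc
  exact hω (finite_of_gridSlab_subsingleton hd hab hm inter_subset_right
    (X.subsingleton_of_notMem_crowded hc))

open Classical in
/-- The law of the longest chain in a box is approximated by that of the longest chain of
occupied cells. -/
lemma PoissonPP.measure_chainLength_mem_le [IsProbabilityMeasure P] (hd : 0 < d)
    (X : PoissonPP d P g)
    (hab : ∀ i, a i < b i) (hg : ∀ z, 0 ≤ g z) (hintg : IntegrableOn g (halfOpenBox a b)) {M : ℝ}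
    (hM : ∀ z ∈ halfOpenBox a b, g z ≤ M) (hm : 0 < m) (U : Set ℕ) :
    P {ω | chainLength d (X.pts ω ∩ halfOpenBox a b) ∈ U} ≤
      ENNReal.ofReal (bernoulliExp (cellProb g a b m) Finset.univ
        fun S => if cellChainLength m S ∈ U then 1 else 0) +
      ENNReal.ofReal (d / m * (M * ∏ i, (b i - a i)) ^ 2) := by
  rw [← measureReal_occ_eq_bernoulliExp (fun κ => X.measurableSet_mem_occupied hab κ)
    (X.measureReal_occupied_subset hab hg hintg) (fun S => cellChainLength m S ∈ U),
    ofReal_measureReal]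
  refine (measure_mono fun ω hω => ?_).trans ((measure_union_le _ _).trans
    (add_le_add le_rfl (X.measure_crowded_le hab hg hintg hM hm)))
  by_cases hc : ω ∈ X.crowded a b m
  · exact Or.inr hc
  · left
    have hslab := X.subsingleton_of_notMem_crowded hc
    have hfin := finite_of_gridSlab_subsingleton hd hab hm inter_subset_right hslab
    have heq : cellChainLength m (X.occupied a b m ω) =
        chainLength d (X.pts ω ∩ halfOpenBox a b) :=
      le_antisymm (cellChainLength_le_chainLength hab hfin)
        (chainLength_le_cellChainLength hab hm inter_subset_right hslab)
    rw [mem_ofPred_eq] at hω ⊢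
    rwa [heq]

lemma one_sub_exp_neg_mem {x : ℝ} (hx : 0 ≤ x) : 1 - Real.exp (-x) ∈ Icc (0 : ℝ) 1 :=
  ⟨sub_nonneg.2 (Real.exp_le_one_iff.2 (neg_nonpos.2 hx)), sub_le_self _ (Real.exp_nonneg _)⟩

lemma cellProb_mem (hg : ∀ z, 0 ≤ g z) (κ : Fin d → Fin m) : cellProb g a b m κ ∈ Icc (0 : ℝ) 1 :=
  one_sub_exp_neg_mem (integral_nonneg hg)

lemma monotone_cellChainLength : Monotone fun S : Finset (Fin d → Fin m) =>
    (cellChainLength m S : ℝ) := fun _ _ h => Nat.cast_le.2 (maxCard_mono h)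

lemma mul_prod_div_pow_nonneg (hab : ∀ i, a i < b i) {M : ℝ} (hM0 : 0 ≤ M) (m : ℕ) :
    0 ≤ M * (∏ i, (b i - a i)) / (m : ℝ) ^ d := by
  have : 0 ≤ ∏ i, (b i - a i) := Finset.prod_nonneg fun i _ => (sub_pos.2 (hab i)).le
  positivity

lemma bernoulliExp_cellProb_le (hab : ∀ i, a i < b i) (hg : ∀ z, 0 ≤ g z)
    (hintg : IntegrableOn g (halfOpenBox a b)) {M : ℝ} (hM0 : 0 ≤ M)
    (hM : ∀ z ∈ halfOpenBox a b, g z ≤ M) (m : ℕ) :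
    bernoulliExp (cellProb g a b m) Finset.univ (fun S => (cellChainLength m S : ℝ)) ≤
      poissonCellMean d m (M * ∏ i, (b i - a i)) := by
  refine bernoulliExp_mono_prob (cellProb_mem hg)
    (fun κ => one_sub_exp_neg_mem (mul_prod_div_pow_nonneg hab hM0 m)) (fun κ => ?_)
    monotone_cellChainLength
  have h := setIntegral_mono_on (hintg.mono_set (gridCell_subset hab κ))
    (integrableOn_const (isBounded_gridCell hab κ).measure_lt_top.ne) (measurableSet_gridCell κ)
    fun z hz => hM z (gridCell_subset hab κ hz)
  rw [setIntegral_const, volume_gridCell hab, smul_eq_mul, mul_comm, ← mul_div_assoc] at h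
  exact sub_le_sub_left (Real.exp_le_exp.2 (neg_le_neg h)) 1

lemma le_bernoulliExp_cellProb (hab : ∀ i, a i < b i) (hg : ∀ z, 0 ≤ g z)
    (hintg : IntegrableOn g (halfOpenBox a b)) {M : ℝ} (hM0 : 0 ≤ M)
    (hM : ∀ z ∈ halfOpenBox a b, M ≤ g z) (m : ℕ) :
    poissonCellMean d m (M * ∏ i, (b i - a i)) ≤
      bernoulliExp (cellProb g a b m) Finset.univ (fun S => (cellChainLength m S : ℝ)) := by
  refine bernoulliExp_mono_prob (fun κ => one_sub_exp_neg_mem (mul_prod_div_pow_nonneg hab hM0 m))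
    (cellProb_mem hg) (fun κ => ?_) monotone_cellChainLength
  have h := setIntegral_mono_on
    (integrableOn_const (isBounded_gridCell hab κ).measure_lt_top.ne)
    (hintg.mono_set (gridCell_subset hab κ)) (measurableSet_gridCell κ)
    fun z hz => hM z (gridCell_subset hab κ hz)
  rw [setIntegral_const, volume_gridCell hab, smul_eq_mul, mul_comm, ← mul_div_assoc] at h
  exact sub_le_sub_left (Real.exp_le_exp.2 (neg_le_neg h)) 1

/-- Chernoff bound for the longest chain of a Poisson process in a box. -/
lemma PoissonPP.measure_chainLength_mem_le_exp [IsProbabilityMeasure P] (hd : 0 < d)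
    (X : PoissonPP d P g)
    (hab : ∀ i, a i < b i) (hg : ∀ z, 0 ≤ g z) (hintg : IntegrableOn g (halfOpenBox a b)) {M : ℝ}
    (hM : ∀ z ∈ halfOpenBox a b, g z ≤ M) {θ t E : ℝ} {U : Set ℕ}
    (hU : ∀ n ∈ U, θ * t ≤ θ * n)
    (hE : ∀ᶠ m : ℕ in atTop, (Real.exp θ - 1) * bernoulliExp (cellProb g a b m) Finset.univ
      (fun S => (cellChainLength m S : ℝ)) ≤ (Real.exp θ - 1) * E) :
    P {ω | chainLength d (X.pts ω ∩ halfOpenBox a b) ∈ U} ≤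
      ENNReal.ofReal (Real.exp ((Real.exp θ - 1) * E - θ * t)) := by
  refine le_of_forall_le_add_div (K := d * (M * ∏ i, (b i - a i)) ^ 2) ?_
  filter_upwards [hE, eventually_gt_atTop 0] with m hEm hm
  rw [mul_div_right_comm]
  refine (X.measure_chainLength_mem_le hd hab hg hintg hM hm U).trans ?_
  gcongr
  refine (bernoulliExp_tail_le isStrictChain_empty IsStrictChain.subset (cellProb_mem hg)
    _ θ t hU).trans ?_
  rw [← Real.exp_add, Real.exp_le_exp]
  linarith

end poissonProcess

section almostSure

lemma exists_chernoff_exponent (A : ℝ) {ε : ℝ} (hε : 0 < ε) :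
    ∃ s > 0, ∃ η > 0, (Real.exp s - 1) * A - s * (A + ε) ≤ -η ∧
      (Real.exp (-s) - 1) * A - (-s) * (A - ε) ≤ -η := by
  have hA : 0 < |A| + 1 := by positivity
  set s := min 1 (ε / (|A| + 1)) with hs
  have hs0 : 0 < s := lt_min one_pos (by positivity)
  have hs1 : s ≤ 1 := min_le_left _ _
  have hsA : s * |A| < ε := by
    have : s * (|A| + 1) ≤ ε := (le_div_iff₀ hA).1 (min_le_right _ _)
    linarith
  have key : ∀ u : ℝ, |u| = s → (Real.exp u - 1) * A ≤ u * A + s ^ 2 * |A| := by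
    intro u hu
    have h := Real.abs_exp_sub_one_sub_id_le (x := u) (by rw [hu]; exact hs1)
    have h2 : (Real.exp u - 1 - u) * A ≤ u ^ 2 * |A| :=
      (le_abs_self _).trans (by rw [abs_mul]; gcongr)
    rw [← sq_abs u, hu] at h2
    linarith
  refine ⟨s, hs0, s * (ε - s * |A|), mul_pos hs0 (by linarith), ?_, ?_⟩
  · linarith [key s (abs_of_pos hs0)]
  · linarith [key (-s) (by rw [abs_neg, abs_of_pos hs0])]

lemma summable_exp_neg_mul_rpow {η q : ℝ} (hη : 0 < η) (hq : 0 < q) :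
    Summable fun n : ℕ => Real.exp (-η * (n : ℝ) ^ q) := by
  have h := (isLittleO_exp_neg_mul_rpow_atTop hη (-(2 / q))).isBigO.comp_tendsto
    ((tendsto_rpow_atTop hq).comp tendsto_natCast_atTop_atTop)
  refine summable_of_isBigO_nat (g := fun n : ℕ => (n : ℝ) ^ (-2 : ℝ))
    (Real.summable_nat_rpow.2 (by norm_num)) (h.congr (fun n => rfl) fun n => ?_)
  simp only [Function.comp_apply]
  rw [← Real.rpow_mul (Nat.cast_nonneg n)]
  congr 1
  field_simp

lemma ae_eventually_not_of_measure_le_exp {Ω : Type*} [MeasurableSpace Ω] {P : Measure Ω}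
    [IsProbabilityMeasure P] {p : ℕ → Ω → Prop} {η q : ℝ} (hη : 0 < η) (hq : 0 < q)
    (h : ∀ᶠ n : ℕ in atTop, P {ω | p n ω} ≤ ENNReal.ofReal (Real.exp (-η * (n : ℝ) ^ q))) :
    ∀ᵐ ω ∂P, ∀ᶠ n in atTop, ¬ p n ω := by
  have hsum : Summable fun n => P.real {ω | p n ω} := by
    refine (summable_exp_neg_mul_rpow hη hq).of_norm_bounded_eventually_nat ?_
    filter_upwards [h] with n hn
    rw [Real.norm_of_nonneg measureReal_nonneg]
    exact ENNReal.toReal_le_of_le_ofReal (Real.exp_nonneg _) hn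
  have htop : ∑' n, P {ω | p n ω} ≠ ⊤ := by
    have := hsum.tsum_ofReal_ne_top
    rwa [tsum_congr fun n => ofReal_measureReal (measure_ne_top P {ω | p n ω})] at this
  have h0 := measure_setOfPred_frequently_eq_zero htop
  rw [ae_iff]
  simpa only [not_eventually, not_not] using h0

variable {d : ℕ} {c : ℝ} {Ω : Type*} [MeasurableSpace Ω] {P : Measure Ω} [IsProbabilityMeasure P]
  {f : (Fin d → ℝ) → ℝ} {a b : Fin d → ℝ}

lemma tendsto_natCast_mul_atTop {V : ℝ} (hV : 0 < V) :
    Tendsto (fun n : ℕ => (n : ℝ) * V) atTop atTop :=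
  tendsto_natCast_atTop_atTop.atTop_mul_const hV

lemma prod_sub_pos (hab : ∀ i, a i < b i) : 0 < ∏ i, (b i - a i) :=
  Finset.prod_pos fun i _ => sub_pos.2 (hab i)

lemma ae_eventually_chainLength_lt (hd : 0 < d) (hc : IsBWConstant d c)
    (PP : ∀ n : ℕ, PoissonPP d P fun z => (n : ℝ) * f z) (hab : ∀ i, a i < b i)
    (hf : ∀ z, 0 ≤ f z) (hintg : IntegrableOn f (halfOpenBox a b)) {M : ℝ} (hM0 : 0 < M)
    (hM : ∀ z ∈ halfOpenBox a b, f z ≤ M) {ε : ℝ} (hε : 0 < ε) :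
    ∀ᵐ ω ∂P, ∀ᶠ n : ℕ in atTop, (chainLength d ((PP n).pts ω ∩ halfOpenBox a b) : ℝ) <
      (c + ε) * (n * (M * ∏ i, (b i - a i))) ^ ((1 : ℝ) / d) := by
  obtain ⟨hq0, -⟩ := one_div_natCast_mem hd
  set V := M * ∏ i, (b i - a i) with hVdef
  set q := (1 : ℝ) / d
  have hV : 0 < V := mul_pos hM0 (prod_sub_pos hab)
  obtain ⟨s, hs, η, hη, hup, -⟩ := exists_chernoff_exponent (c + ε / 2) (half_pos hε)
  have hVq : 0 < V ^ q := Real.rpow_pos_of_pos hV q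
  have hmain := ae_eventually_not_of_measure_le_exp (P := P)
    (p := fun n ω => (c + ε) * (n * V) ^ q ≤
      (chainLength d ((PP n).pts ω ∩ halfOpenBox a b) : ℝ)) (mul_pos hη hVq) hq0 ?_
  · simpa only [not_le] using hmain
  filter_upwards [(tendsto_natCast_mul_atTop hV).eventually
    (poissonCellMean_le hd hc (half_pos hε))] with n hn
  have hg : ∀ z, 0 ≤ (n : ℝ) * f z := fun z => mul_nonneg (Nat.cast_nonneg n) (hf z)
  have hgint : IntegrableOn (fun z => (n : ℝ) * f z) (halfOpenBox a b) := hintg.const_mul _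
  have hgM : ∀ z ∈ halfOpenBox a b, (n : ℝ) * f z ≤ n * M := fun z hz =>
    mul_le_mul_of_nonneg_left (hM z hz) (Nat.cast_nonneg n)
  have h := (PP n).measure_chainLength_mem_le_exp hd hab hg hgint hgM (θ := s)
    (t := (c + ε) * (n * V) ^ q) (E := (c + ε / 2) * (n * V) ^ q)
    (U := {k | (c + ε) * (n * V) ^ q ≤ (k : ℝ)})
    (fun k hk => mul_le_mul_of_nonneg_left hk hs.le) ?_
  · refine h.trans (ENNReal.ofReal_le_ofReal (Real.exp_le_exp.2 ?_))
    have hr : ((n : ℝ) * V) ^ q = (n : ℝ) ^ q * V ^ q := Real.mul_rpow (Nat.cast_nonneg n) hV.le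
    have h2 := mul_le_mul_of_nonneg_right hup
      (Real.rpow_nonneg (mul_nonneg (Nat.cast_nonneg n) hV.le) q)
    have h3 : c + ε / 2 + ε / 2 = c + ε := by ring
    rw [h3] at h2
    calc _ = ((Real.exp s - 1) * (c + ε / 2) - s * (c + ε)) * (n * V) ^ q := by ring
      _ ≤ _ := h2
      _ = _ := by rw [hr]; ring
  · filter_upwards [eventually_gt_atTop 0] with m hm
    refine mul_le_mul_of_nonneg_left ?_ (by linarith [Real.add_one_le_exp s])
    refine (bernoulliExp_cellProb_le hab hg hgint (mul_nonneg (Nat.cast_nonneg n) hM0.le)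
      hgM m).trans ?_
    rw [mul_assoc]
    exact hn m hm

lemma ae_eventually_lt_chainLength (hd : 0 < d) (hc : IsBWConstant d c)
    (PP : ∀ n : ℕ, PoissonPP d P fun z => (n : ℝ) * f z) (hab : ∀ i, a i < b i)
    (hf : ∀ z, 0 ≤ f z) (hintg : IntegrableOn f (halfOpenBox a b)) {C M : ℝ} (hM0 : 0 < M)
    (hC : ∀ z ∈ halfOpenBox a b, f z ≤ C) (hM : ∀ z ∈ halfOpenBox a b, M ≤ f z)
    {ε : ℝ} (hε : 0 < ε) :
    ∀ᵐ ω ∂P, ∀ᶠ n : ℕ in atTop, (c - ε) * (n * (M * ∏ i, (b i - a i))) ^ ((1 : ℝ) / d) <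
      (chainLength d ((PP n).pts ω ∩ halfOpenBox a b) : ℝ) := by
  obtain ⟨hq0, -⟩ := one_div_natCast_mem hd
  set V := M * ∏ i, (b i - a i) with hVdef
  set q := (1 : ℝ) / d
  have hV : 0 < V := mul_pos hM0 (prod_sub_pos hab)
  obtain ⟨s, hs, η, hη, -, hlow⟩ := exists_chernoff_exponent (c - ε / 2) (half_pos hε)
  have hVq : 0 < V ^ q := Real.rpow_pos_of_pos hV q
  have hmain := ae_eventually_not_of_measure_le_exp (P := P)
    (p := fun n ω => (chainLength d ((PP n).pts ω ∩ halfOpenBox a b) : ℝ) ≤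
      (c - ε) * (n * V) ^ q) (mul_pos hη hVq) hq0 ?_
  · simpa only [not_le] using hmain
  filter_upwards [(tendsto_natCast_mul_atTop hV).eventually
    (le_poissonCellMean hd hc (half_pos hε))] with n hn
  have hg : ∀ z, 0 ≤ (n : ℝ) * f z := fun z => mul_nonneg (Nat.cast_nonneg n) (hf z)
  have hgint : IntegrableOn (fun z => (n : ℝ) * f z) (halfOpenBox a b) := hintg.const_mul _
  have hgC : ∀ z ∈ halfOpenBox a b, (n : ℝ) * f z ≤ n * C := fun z hz =>
    mul_le_mul_of_nonneg_left (hC z hz) (Nat.cast_nonneg n)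
  have hgM : ∀ z ∈ halfOpenBox a b, (n : ℝ) * M ≤ n * f z := fun z hz =>
    mul_le_mul_of_nonneg_left (hM z hz) (Nat.cast_nonneg n)
  have h := (PP n).measure_chainLength_mem_le_exp hd hab hg hgint hgC (θ := -s)
    (t := (c - ε) * (n * V) ^ q) (E := (c - ε / 2) * (n * V) ^ q)
    (U := {k | (k : ℝ) ≤ (c - ε) * (n * V) ^ q})
    (fun k hk => mul_le_mul_of_nonpos_left hk (by linarith)) ?_
  · refine h.trans (ENNReal.ofReal_le_ofReal (Real.exp_le_exp.2 ?_))
    have hr : ((n : ℝ) * V) ^ q = (n : ℝ) ^ q * V ^ q := Real.mul_rpow (Nat.cast_nonneg n) hV.le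
    have h2 := mul_le_mul_of_nonneg_right hlow
      (Real.rpow_nonneg (mul_nonneg (Nat.cast_nonneg n) hV.le) q)
    have h3 : c - ε / 2 - ε / 2 = c - ε := by ring
    rw [h3] at h2
    calc _ = ((Real.exp (-s) - 1) * (c - ε / 2) - (-s) * (c - ε)) * (n * V) ^ q := by ring
      _ ≤ _ := h2
      _ = _ := by rw [hr]; ring
  · filter_upwards [hn] with m hm
    refine mul_le_mul_of_nonpos_left ?_ ?_
    · refine le_trans ?_ (le_bernoulliExp_cellProb hab hg hgint
        (mul_nonneg (Nat.cast_nonneg n) hM0.le) hgM m)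
      rw [mul_assoc]
      exact hm
    · linarith [Real.exp_le_one_iff.2 (neg_nonpos.2 hs.le)]

end almostSure

section envelopes

variable {d : ℕ} {f : (Fin d → ℝ) → ℝ}

lemma MemB.exists_isOpen_le (hf : MemB d f) {K : Set (Fin d → ℝ)} (hK : IsCompact K) :
    ∃ C : ℝ, ∃ U, IsOpen U ∧ K ⊆ U ∧ ∀ z ∈ U, f z ≤ C := by
  refine hK.induction_on (p := fun K => ∃ C : ℝ, ∃ U, IsOpen U ∧ K ⊆ U ∧ ∀ z ∈ U, f z ≤ C)
    ⟨0, ∅, isOpen_empty, Subset.rfl, by simp⟩ ?_ ?_ ?_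
  · rintro s t hst ⟨C, U, hU, htU, hC⟩
    exact ⟨C, U, hU, hst.trans htU, hC⟩
  · rintro s t ⟨C, U, hU, hsU, hC⟩ ⟨C', U', hU', htU', hC'⟩
    refine ⟨max C C', U ∪ U', hU.union hU', union_subset_union hsU htU', ?_⟩
    rintro z (hz | hz)
    · exact (hC z hz).trans (le_max_left _ _)
    · exact (hC' z hz).trans (le_max_right _ _)
  · intro x _
    obtain ⟨W, hW, C, hC⟩ := hf.2.2 x
    obtain ⟨U, hUW, hU, hxU⟩ := mem_nhds_iff.1 hW
    exact ⟨U, mem_nhdsWithin_of_mem_nhds (hU.mem_nhds hxU), C, U, hU, Subset.rfl,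
      fun z hz => hC ⟨z, hUW hz, rfl⟩⟩

lemma MemB.exists_le_halfOpenBox (hf : MemB d f) (a b : Fin d → ℝ) :
    ∃ C : ℝ, ∀ z ∈ halfOpenBox a b, f z ≤ C := by
  obtain ⟨C, U, -, hU, hC⟩ := hf.exists_isOpen_le (isCompact_Icc (a := a) (b := b))
  exact ⟨C, fun z hz => hC z (hU (halfOpenBox_subset_Icc a b hz))⟩

lemma MemB.integrableOn_halfOpenBox (hf : MemB d f) (a b : Fin d → ℝ) :
    IntegrableOn f (halfOpenBox a b) := by
  obtain ⟨C, hC⟩ := hf.exists_le_halfOpenBox a b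
  refine Measure.integrableOn_of_bounded (M := C) (isBounded_halfOpenBox a b).measure_lt_top.ne
    hf.1.aestronglyMeasurable ?_
  refine (ae_restrict_iff' (measurableSet_halfOpenBox a b)).2 (ae_of_all _ fun z hz => ?_)
  rw [Real.norm_of_nonneg (hf.2.1 z)]
  exact hC z hz

lemma MemB.isBoundedUnder_le (hf : MemB d f) (x : Fin d → ℝ) :
    IsBoundedUnder (· ≤ ·) (𝓝 x) f := by
  obtain ⟨W, hW, C, hC⟩ := hf.2.2 x
  exact isBoundedUnder_of_eventually_le (a := C)
    (by filter_upwards [hW] with z hz using hC ⟨z, hz, rfl⟩)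

lemma MemB.isBoundedUnder_ge (hf : MemB d f) (x : Fin d → ℝ) :
    IsBoundedUnder (· ≥ ·) (𝓝 x) f :=
  isBoundedUnder_of_eventually_ge (a := 0) (Eventually.of_forall hf.2.1)

lemma MemB.le_upperEnv (hf : MemB d f) (x : Fin d → ℝ) : f x ≤ upperEnv d f x :=
  le_limsup_of_frequently_le
    ((frequently_pure (p := fun y => f x ≤ f y)).2 le_rfl |>.filter_mono (pure_le_nhds x))
    (hf.isBoundedUnder_le x)

lemma MemB.lowerEnv_le (hf : MemB d f) (x : Fin d → ℝ) : lowerEnv d f x ≤ f x :=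
  liminf_le_of_frequently_le
    ((frequently_pure (p := fun y => f y ≤ f x)).2 le_rfl |>.filter_mono (pure_le_nhds x))
    (hf.isBoundedUnder_ge x)

lemma MemB.lowerEnv_nonneg (hf : MemB d f) (x : Fin d → ℝ) : 0 ≤ lowerEnv d f x :=
  le_liminf_of_le (hf.isBoundedUnder_le x).isCoboundedUnder_ge (Eventually.of_forall hf.2.1)

lemma MemB.bddAbove_upperEnv (hf : MemB d f) {K : Set (Fin d → ℝ)} (hK : IsCompact K) :
    BddAbove (upperEnv d f '' K) := by
  obtain ⟨C, U, hU, hKU, hC⟩ := hf.exists_isOpen_le hK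
  refine ⟨C, ?_⟩
  rintro _ ⟨z, hz, rfl⟩
  exact limsup_le_of_le (hf.isBoundedUnder_ge z).isCoboundedUnder_le
    (by filter_upwards [hU.mem_nhds (hKU hz)] with y hy using hC y hy)

lemma MemB.bddBelow_lowerEnv (hf : MemB d f) (K : Set (Fin d → ℝ)) :
    BddBelow (lowerEnv d f '' K) := by
  refine ⟨0, ?_⟩
  rintro _ ⟨z, -, rfl⟩
  exact hf.lowerEnv_nonneg z

/-- If `f* < M` on a compact set then `f < M` on a thickening of it. -/
lemma MemB.exists_thickening_lt (hf : MemB d f) {K : Set (Fin d → ℝ)} (hK : IsCompact K) {M : ℝ}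
    (hM : ∀ z ∈ K, upperEnv d f z < M) : ∃ δ > 0, ∀ z ∈ Metric.thickening δ K, f z < M := by
  obtain ⟨δ, hδ, hsub⟩ := hK.exists_thickening_subset_open
    (t := {z | ∀ᶠ y in 𝓝 z, f y < M}) isOpen_setOfPred_eventually_nhds
    fun z hz => eventually_lt_of_limsup_lt (hM z hz) (hf.isBoundedUnder_le z)
  exact ⟨δ, hδ, fun z hz => (hsub hz).self_of_nhds⟩

end envelopes

section simplex

variable {d : ℕ} {x v : Fin d → ℝ}

lemma simplexS_subset_Icc (hv : ∀ i, 0 < v i) :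
    simplexS d x v ⊆ Icc (fun i => x i - 1 / v i) x := by
  rintro z ⟨hzx, hz⟩
  refine ⟨fun i => ?_, hzx⟩
  have h := (Finset.single_le_sum (f := fun i => (x i - z i) * v i)
    (fun i _ => mul_nonneg (sub_nonneg.2 (hzx i)) (hv i).le) (Finset.mem_univ i)).trans hz
  have : x i - z i ≤ 1 / v i := (le_div_iff₀ (hv i)).2 h
  linarith

lemma isCompact_simplexS (hv : ∀ i, 0 < v i) : IsCompact (simplexS d x v) := by
  refine isCompact_Icc.of_isClosed_subset ?_ (simplexS_subset_Icc hv)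
  have hcont : Continuous fun z : Fin d → ℝ => ∑ i, (x i - z i) * v i := by fun_prop
  exact isClosed_Iic.inter (isClosed_le hcont continuous_const)

lemma self_mem_simplexS (x v : Fin d → ℝ) : x ∈ simplexS d x v := by
  simp [simplexS]

lemma simplexS_of_le (hv : ∀ i, 0 < v i) {z w : Fin d → ℝ} (hz : z ∈ simplexS d x v)
    (hzw : z ≤ w) (hwx : w ≤ x) : w ∈ simplexS d x v := by
  refine ⟨hwx, (Finset.sum_le_sum fun i _ => ?_).trans hz.2⟩
  exact mul_le_mul_of_nonneg_right (sub_le_sub_left (hzw i) _) (hv i).le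

lemma mem_thickening_simplexS (hv : ∀ i, 0 < v i) {δ : ℝ} (hδ : 0 < δ) {z y : Fin d → ℝ}
    (hz : z ∈ simplexS d x v) (h1 : ∀ i, z i - δ < y i) (h2 : ∀ i, y i < x i + δ) :
    y ∈ Metric.thickening δ (simplexS d x v) := by
  refine Metric.mem_thickening_iff.2 ⟨fun i => max (z i) (min (y i) (x i)),
    simplexS_of_le hv hz (fun i => le_max_left _ _)
      (fun i => max_le (hz.1 i) (min_le_right _ _)), ?_⟩
  refine (dist_pi_lt_iff hδ).2 fun i => ?_
  have hzx := hz.1 i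
  rw [Real.dist_eq, abs_lt]
  rcases max_cases (z i) (min (y i) (x i)) with h | h <;>
    rcases min_cases (y i) (x i) with h' | h' <;> rw [h.1] <;>
    constructor <;> linarith [h1 i, h2 i]

/-- The arithmetic-geometric mean inequality in the form of a bound for the volume of a box. -/
lemma rpow_prod_mul_le (hd : 0 < d) {s : Fin d → ℝ} (hs : ∀ i, 0 ≤ s i) :
    (∏ i, s i) ^ ((1 : ℝ) / d) ≤ (∑ i, s i) / d := by
  have hd' : (d : ℝ) ≠ 0 := by exact_mod_cast hd.ne'
  have h := Real.geom_mean_le_arith_mean_weighted Finset.univ (fun _ : Fin d => (1 : ℝ) / d) s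
    (fun _ _ => by positivity) (by simp [hd']) fun i _ => hs i
  rw [Real.finsetProd_rpow _ _ fun i _ => hs i, ← Finset.mul_sum] at h
  exact h.trans_eq (one_div_mul_eq_div _ _)

end simplex

section typical

variable {d : ℕ} {c : ℝ} {f : (Fin d → ℝ) → ℝ}

/-- The properties of the rescaled samples on boxes with rational vertices which hold almost
surely. -/
structure IsTypical (d : ℕ) (c : ℝ) (f : (Fin d → ℝ) → ℝ) (A : ℕ → Set (Fin d → ℝ)) : Prop where
  finite : ∀ a b : Fin d → ℚ, (∀ i, a i < b i) → ∀ n,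
    (A n ∩ halfOpenBox (fun i => (a i : ℝ)) fun i => (b i : ℝ)).Finite
  upper : ∀ a b : Fin d → ℚ, (∀ i, a i < b i) → ∀ M : ℚ, 0 < M →
    (∀ z ∈ halfOpenBox (fun i => (a i : ℝ)) fun i => (b i : ℝ), f z ≤ M) →
    ∀ R : ℝ, c * (M * ∏ i, ((b i : ℝ) - a i)) ^ ((1 : ℝ) / d) < R →
    ∀ᶠ n : ℕ in atTop, (n : ℝ) ^ (-(1 : ℝ) / d) *
      (chainLength d (A n ∩ halfOpenBox (fun i => (a i : ℝ)) fun i => (b i : ℝ)) : ℝ) ≤ R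
  lower : ∀ a b : Fin d → ℚ, (∀ i, a i < b i) → ∀ M : ℚ, 0 < M →
    (∀ z ∈ halfOpenBox (fun i => (a i : ℝ)) fun i => (b i : ℝ), M ≤ f z) →
    ∀ R : ℝ, R < c * (M * ∏ i, ((b i : ℝ) - a i)) ^ ((1 : ℝ) / d) →
    ∀ᶠ n : ℕ in atTop, R ≤ (n : ℝ) ^ (-(1 : ℝ) / d) *
      (chainLength d (A n ∩ halfOpenBox (fun i => (a i : ℝ)) fun i => (b i : ℝ)) : ℝ)

lemma rpow_neg_mul_rpow_mul {n : ℕ} (hn : 0 < n) {W : ℝ} (hW : 0 ≤ W) (k : ℝ) :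
    (n : ℝ) ^ (-(1 : ℝ) / d) * (k * (n * W) ^ ((1 : ℝ) / d)) = k * W ^ ((1 : ℝ) / d) := by
  have hn' : (0 : ℝ) < n := by exact_mod_cast hn
  rw [Real.mul_rpow hn'.le hW, neg_div, Real.rpow_neg hn'.le]
  have := (Real.rpow_pos_of_pos hn' ((1 : ℝ) / d)).ne'
  field_simp

lemma ae_isTypical (hd : 0 < d) (hc : IsBWConstant d c) (hf : MemB d f)
    {Ω : Type*} [MeasurableSpace Ω] {P : Measure Ω} [IsProbabilityMeasure P]
    (PP : ∀ n : ℕ, PoissonPP d P fun z => (n : ℝ) * f z) :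
    ∀ᵐ ω ∂P, IsTypical d c f fun n => (PP n).pts ω := by
  have hlt : ∀ {a b : Fin d → ℚ}, (∀ i, a i < b i) → ∀ i, (a i : ℝ) < b i := fun h i =>
    Rat.cast_lt.2 (h i)
  have hfin : ∀ᵐ ω ∂P, ∀ a b : Fin d → ℚ, (∀ i, a i < b i) → ∀ n : ℕ,
      ((PP n).pts ω ∩ halfOpenBox (fun i => (a i : ℝ)) fun i => (b i : ℝ)).Finite := by
    simp only [ae_all_iff, eventually_imp_distrib_left]
    intro a b hab n
    obtain ⟨C, hC⟩ := hf.exists_le_halfOpenBox (fun i => (a i : ℝ)) fun i => (b i : ℝ)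
    exact (PP n).ae_finite hd (hlt hab) (fun z => mul_nonneg (Nat.cast_nonneg n) (hf.2.1 z))
      ((hf.integrableOn_halfOpenBox _ _).const_mul _) (M := n * C)
      fun z hz => mul_le_mul_of_nonneg_left (hC z hz) (Nat.cast_nonneg n)
  have hup : ∀ᵐ ω ∂P, ∀ a b : Fin d → ℚ, (∀ i, a i < b i) → ∀ M : ℚ, 0 < M →
      (∀ z ∈ halfOpenBox (fun i => (a i : ℝ)) fun i => (b i : ℝ), f z ≤ M) → ∀ k : ℕ,
      ∀ᶠ n : ℕ in atTop, (chainLength d ((PP n).pts ω ∩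
        halfOpenBox (fun i => (a i : ℝ)) fun i => (b i : ℝ)) : ℝ) <
        (c + 1 / ((k : ℝ) + 1)) * (n * (M * ∏ i, ((b i : ℝ) - a i))) ^ ((1 : ℝ) / d) := by
    simp only [ae_all_iff, eventually_imp_distrib_left]
    intro a b hab M hM hMf k
    exact ae_eventually_chainLength_lt hd hc PP (hlt hab) hf.2.1 (hf.integrableOn_halfOpenBox _ _)
      (Rat.cast_pos.2 hM) hMf Nat.one_div_pos_of_nat
  have hlow : ∀ᵐ ω ∂P, ∀ a b : Fin d → ℚ, (∀ i, a i < b i) → ∀ M : ℚ, 0 < M →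
      (∀ z ∈ halfOpenBox (fun i => (a i : ℝ)) fun i => (b i : ℝ), M ≤ f z) → ∀ k : ℕ,
      ∀ᶠ n : ℕ in atTop,
        (c - 1 / ((k : ℝ) + 1)) * (n * (M * ∏ i, ((b i : ℝ) - a i))) ^ ((1 : ℝ) / d) <
        (chainLength d ((PP n).pts ω ∩
          halfOpenBox (fun i => (a i : ℝ)) fun i => (b i : ℝ)) : ℝ) := by
    simp only [ae_all_iff, eventually_imp_distrib_left]
    intro a b hab M hM hMf k
    obtain ⟨C, hC⟩ := hf.exists_le_halfOpenBox (fun i => (a i : ℝ)) fun i => (b i : ℝ)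
    exact ae_eventually_lt_chainLength hd hc PP (hlt hab) hf.2.1 (hf.integrableOn_halfOpenBox _ _)
      (Rat.cast_pos.2 hM) hC hMf Nat.one_div_pos_of_nat
  have hW : ∀ {a b : Fin d → ℚ} {M : ℚ}, (∀ i, a i < b i) → 0 < M →
      0 ≤ (M : ℝ) * ∏ i, ((b i : ℝ) - a i) := fun hab hM =>
    mul_nonneg (Rat.cast_nonneg.2 hM.le) (prod_sub_pos (hlt hab)).le
  filter_upwards [hfin, hup, hlow] with ω h1 h2 h3
  refine ⟨h1, fun a b hab M hM hMf R hR => ?_, fun a b hab M hM hMf R hR => ?_⟩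
  · have hlim : Tendsto (fun k : ℕ => (c + 1 / ((k : ℝ) + 1)) *
        (M * ∏ i, ((b i : ℝ) - a i)) ^ ((1 : ℝ) / d)) atTop
        (𝓝 (c * (M * ∏ i, ((b i : ℝ) - a i)) ^ ((1 : ℝ) / d))) := by
      simpa using (tendsto_one_div_add_atTop_nhds_zero_nat.const_add c).mul_const
        ((M * ∏ i, ((b i : ℝ) - a i)) ^ ((1 : ℝ) / d))
    obtain ⟨k, hk⟩ := (hlim.eventually (gt_mem_nhds hR)).exists
    filter_upwards [h2 a b hab M hM hMf k, eventually_gt_atTop 0] with n hn hn0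
    have h := mul_le_mul_of_nonneg_left hn.le
      (Real.rpow_nonneg (Nat.cast_nonneg n) (-(1 : ℝ) / d))
    rw [rpow_neg_mul_rpow_mul hn0 (hW hab hM)] at h
    exact h.trans hk.le
  · have hlim : Tendsto (fun k : ℕ => (c - 1 / ((k : ℝ) + 1)) *
        (M * ∏ i, ((b i : ℝ) - a i)) ^ ((1 : ℝ) / d)) atTop
        (𝓝 (c * (M * ∏ i, ((b i : ℝ) - a i)) ^ ((1 : ℝ) / d))) := by
      simpa using (tendsto_one_div_add_atTop_nhds_zero_nat.const_sub c).mul_const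
        ((M * ∏ i, ((b i : ℝ) - a i)) ^ ((1 : ℝ) / d))
    obtain ⟨k, hk⟩ := (hlim.eventually (lt_mem_nhds hR)).exists
    filter_upwards [h3 a b hab M hM hMf k, eventually_gt_atTop 0] with n hn hn0
    have h := mul_le_mul_of_nonneg_left hn.le
      (Real.rpow_nonneg (Nat.cast_nonneg n) (-(1 : ℝ) / d))
    rw [rpow_neg_mul_rpow_mul hn0 (hW hab hM)] at h
    exact hk.le.trans h

end typical

section deterministic

variable {d : ℕ} {c : ℝ} {f : (Fin d → ℝ) → ℝ} {A : ℕ → Set (Fin d → ℝ)} {x v : Fin d → ℝ}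

lemma exists_rat_pi_btwn {s t : Fin d → ℝ} (h : ∀ i, s i < t i) :
    ∃ q : Fin d → ℚ, ∀ i, s i < q i ∧ (q i : ℝ) < t i := by
  choose q hq using fun i => exists_rat_btwn (h i)
  exact ⟨q, hq⟩

/-- A chain in `B` lies in one of finitely many upper orthants covering `B`. -/
lemma exists_chainLength_le {B X : Set (Fin d → ℝ)} {ι : Type*} {T : Finset ι}
    (hT : T.Nonempty) {a : ι → Fin d → ℝ} {b : Fin d → ℝ}
    (hcover : ∀ y ∈ B, ∃ t ∈ T, a t ≤ y) (hb : ∀ y ∈ B, ∀ i, y i < b i)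
    (hfin : ∀ t ∈ T, (X ∩ halfOpenBox (a t) b).Finite) :
    ∃ t ∈ T, chainLength d (X ∩ B) ≤ chainLength d (X ∩ halfOpenBox (a t) b) := by
  obtain ⟨t₀, ht₀, hsup⟩ := Finset.exists_mem_eq_sup T hT
    fun t => chainLength d (X ∩ halfOpenBox (a t) b)
  refine ⟨t₀, ht₀, hsup ▸ chainLength_le fun C hCX hC => ?_⟩
  rcases C.eq_empty_or_nonempty with rfl | hne
  · simp
  obtain ⟨y, hyC, hy⟩ := C.exists_minimal hne
  obtain ⟨t, ht, hty⟩ := hcover y (hCX hyC).2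
  refine (card_le_chainLength (hfin t ht) (fun w hw => ⟨(hCX hw).1, ?_⟩) hC).trans
    (Finset.le_sup (f := fun t => chainLength d (X ∩ halfOpenBox (a t) b)) ht)
  have hyw : y ≤ w := (hC.total hyC hw).elim id fun h => hy hw h
  exact mem_halfOpenBox.2 fun i => ⟨(hty i).trans (hyw i), hb w (hCX hw).2 i⟩

lemma IsTypical.finite_simplexS (hA : IsTypical d c f A) (hv : ∀ i, 0 < v i) (n : ℕ) :
    (A n ∩ simplexS d x v).Finite := by
  obtain ⟨a, ha⟩ := exists_rat_pi_btwn (s := fun i => x i - 1 / v i - 1)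
    (t := fun i => x i - 1 / v i) fun i => by linarith
  obtain ⟨b, hb⟩ := exists_rat_pi_btwn (s := x) (t := fun i => x i + 1) fun i => by linarith
  have hsub : simplexS d x v ⊆ halfOpenBox (fun i => (a i : ℝ)) fun i => (b i : ℝ) := fun z hz =>
    mem_halfOpenBox.2 fun i => ⟨(ha i).2.le.trans ((simplexS_subset_Icc hv hz).1 i),
      (hz.1 i).trans_lt (hb i).1⟩
  refine (hA.finite a b (fun i => ?_) n).subset (inter_subset_inter_right _ hsub)
  have : 0 < 1 / v i := one_div_pos.2 (hv i)
  exact_mod_cast (ha i).2.trans ((sub_lt_self (x i) this).trans (hb i).1)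

/-- Splitting off the constraint vector from the volume of a box. -/
lemma rpow_mul_prod_eq (hv : ∀ i, 0 < v i) {M : ℝ} (hM : 0 ≤ M) {s : Fin d → ℝ}
    (hs : ∀ i, 0 ≤ s i) (q : ℝ) :
    (M * ∏ i, s i) ^ q = (M / ∏ i, v i) ^ q * (∏ i, s i * v i) ^ q := by
  have hvp : 0 < ∏ i, v i := Finset.prod_pos fun i _ => hv i
  rw [← Real.mul_rpow (by positivity)
    (Finset.prod_nonneg fun i _ => mul_nonneg (hs i) (hv i).le), Finset.prod_mul_distrib]
  congr 1
  field_simp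

lemma IsTypical.eventually_le (hA : IsTypical d c f A) (hd : 0 < d) (hc : 0 < c) (hf : MemB d f)
    (hv : ∀ i, 0 < v i) {R : ℝ}
    (hR : c / d * (sSup (upperEnv d f '' simplexS d x v) / ∏ i, v i) ^ ((1 : ℝ) / d) < R) :
    ∀ᶠ n : ℕ in atTop,
      (n : ℝ) ^ (-(1 : ℝ) / d) * (chainLength d (A n ∩ simplexS d x v) : ℝ) ≤ R := by
  obtain ⟨hq0, -⟩ := one_div_natCast_mem hd
  set q := (1 : ℝ) / d with hq
  have hvp : 0 < ∏ i, v i := Finset.prod_pos fun i _ => hv i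
  have hcomp : IsCompact (simplexS d x v) := isCompact_simplexS hv
  have hle : ∀ z ∈ simplexS d x v, upperEnv d f z ≤ sSup (upperEnv d f '' simplexS d x v) :=
    fun z hz => le_csSup (hf.bddAbove_upperEnv hcomp) ⟨z, hz, rfl⟩
  set M := sSup (upperEnv d f '' simplexS d x v) with hMdef
  have hM0 : 0 ≤ M := ((hf.2.1 x).trans (hf.le_upperEnv x)).trans (hle x (self_mem_simplexS x v))
  obtain ⟨M', hMM', hRM'⟩ : ∃ M' : ℚ, M < M' ∧ c / d * ((M' : ℝ) / ∏ i, v i) ^ q < R := by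
    have hcont : ContinuousAt (fun s : ℝ => c / d * (s / ∏ i, v i) ^ q) M :=
      ((continuousAt_id.div_const _).rpow_const (Or.inr hq0.le)).const_mul _
    obtain ⟨t, ht, hsub⟩ := exists_Ico_subset_of_mem_nhds (hcont.eventually (gt_mem_nhds hR))
      (exists_gt M)
    obtain ⟨M', h1, h2⟩ := exists_rat_btwn ht
    exact ⟨M', h1, hsub ⟨h1.le, h2⟩⟩
  have hM'0 : (0 : ℝ) < M' := hM0.trans_lt hMM'
  obtain ⟨ρ, hρ, hfρ⟩ := hf.exists_thickening_lt hcomp fun z hz => (hle z hz).trans_lt hMM'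
  obtain ⟨δ, hδ0, hδρ, hRδ⟩ : ∃ δ > 0, δ < ρ ∧
      c / d * ((M' : ℝ) / ∏ i, v i) ^ q * (1 + 2 * δ * ∑ i, v i) < R := by
    have hcont : Continuous fun δ : ℝ =>
      c / d * ((M' : ℝ) / ∏ i, v i) ^ q * (1 + 2 * δ * ∑ i, v i) := by fun_prop
    have h := (hcont.tendsto 0).eventually (gt_mem_nhds
      (show _ < R by simpa using hRM'))
    obtain ⟨t, ht, hsub⟩ := exists_Ico_subset_of_mem_nhds (h.and (gt_mem_nhds hρ)) (exists_gt 0)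
    have hmem := hsub (show t / 2 ∈ Ico 0 t from ⟨by linarith, by linarith⟩)
    exact ⟨t / 2, by linarith, hmem.2, hmem.1⟩
  obtain ⟨b, hb⟩ := exists_rat_pi_btwn (s := x) (t := fun i => x i + δ) fun i => by linarith
  choose a ha using fun z : Fin d → ℝ => exists_rat_pi_btwn (s := fun i => z i - δ) (t := z)
    fun i => by linarith
  obtain ⟨T, hTS, hT⟩ := hcomp.elim_nhds_subcover (fun z => {y | ∀ i, (a z i : ℝ) < y i})
    fun z _ => (eventually_all.2 fun i =>
      (continuous_apply i).continuousAt.eventually (lt_mem_nhds (ha z i).2))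
  have hcover : ∀ y ∈ simplexS d x v, ∃ z ∈ T, (fun i => (a z i : ℝ)) ≤ y := by
    intro y hy
    obtain ⟨z, hz, hzy⟩ := mem_iUnion₂.1 (hT hy)
    exact ⟨z, hz, fun i => (hzy i).le⟩
  have hTne : T.Nonempty := by
    obtain ⟨z, hz, -⟩ := hcover x (self_mem_simplexS x v)
    exact ⟨z, hz⟩
  have hab : ∀ z ∈ T, ∀ i, a z i < b i := fun z hz i => by
    exact_mod_cast ((ha z i).2.trans_le ((hTS z hz).1 i)).trans (hb i).1
  have hbox : ∀ z ∈ T, ∀ᶠ n : ℕ in atTop, (n : ℝ) ^ (-(1 : ℝ) / d) *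
      (chainLength d (A n ∩ halfOpenBox (fun i => (a z i : ℝ)) fun i => (b i : ℝ)) : ℝ) ≤ R := by
    intro z hz
    have hs : ∀ i, 0 ≤ (b i : ℝ) - a z i := fun i =>
      sub_nonneg.2 (Rat.cast_le.2 (hab z hz i).le)
    refine hA.upper (a z) b (hab z hz) M' (by exact_mod_cast hM'0) (fun y hy => ?_) R ?_
    · have hy := mem_halfOpenBox.1 hy
      refine (hfρ y (Metric.thickening_mono hδρ.le _ (mem_thickening_simplexS hv hδ0 (hTS z hz)
        (fun i => (ha z i).1.trans_le (hy i).1) fun i => (hy i).2.trans (hb i).2))).le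
    · rw [rpow_mul_prod_eq hv hM'0.le hs]
      have hsum : ∑ i, ((b i : ℝ) - a z i) * v i ≤ 1 + 2 * δ * ∑ i, v i := by
        calc ∑ i, ((b i : ℝ) - a z i) * v i ≤ ∑ i, ((x i - z i) * v i + 2 * δ * v i) := by
              refine Finset.sum_le_sum fun i _ => ?_
              rw [← add_mul]
              refine mul_le_mul_of_nonneg_right ?_ (hv i).le
              linarith [(ha z i).1, (hb i).2]
          _ = ∑ i, (x i - z i) * v i + 2 * δ * ∑ i, v i := by
              rw [Finset.sum_add_distrib, Finset.mul_sum]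
          _ ≤ _ := by linarith [(hTS z hz).2]
      have hamgm := (rpow_prod_mul_le hd fun i => mul_nonneg (hs i) (hv i).le).trans
        (div_le_div_of_nonneg_right hsum (Nat.cast_nonneg d))
      refine lt_of_le_of_lt ?_ hRδ
      calc _ ≤ c * (((M' : ℝ) / ∏ i, v i) ^ q * ((1 + 2 * δ * ∑ i, v i) / d)) := by gcongr
        _ = _ := by ring
  filter_upwards [(T.eventually_all (l := atTop)).2 hbox] with n hn
  obtain ⟨z, hz, hzle⟩ := exists_chainLength_le (X := A n) hTne hcover
    (fun y hy i => (hy.1 i).trans_lt (hb i).1) fun z hz => hA.finite (a z) b (hab z hz) n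
  refine le_trans ?_ (hn z hz)
  gcongr

lemma IsTypical.eventually_ge (hA : IsTypical d c f A) (hd : 0 < d) (hc : 0 < c) (hf : MemB d f)
    (hv : ∀ i, 0 < v i) {R : ℝ}
    (hR : R < c / d * (sInf (lowerEnv d f '' simplexS d x v) / ∏ i, v i) ^ ((1 : ℝ) / d)) :
    ∀ᶠ n : ℕ in atTop,
      R ≤ (n : ℝ) ^ (-(1 : ℝ) / d) * (chainLength d (A n ∩ simplexS d x v) : ℝ) := by
  obtain ⟨hq0, -⟩ := one_div_natCast_mem hd
  have hd' : (0 : ℝ) < d := by exact_mod_cast hd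
  set q := (1 : ℝ) / d with hq
  have hvp : 0 < ∏ i, v i := Finset.prod_pos fun i _ => hv i
  have hle : ∀ z ∈ simplexS d x v, sInf (lowerEnv d f '' simplexS d x v) ≤ f z := fun z hz =>
    (csInf_le (hf.bddBelow_lowerEnv _) ⟨z, hz, rfl⟩).trans (hf.lowerEnv_le z)
  have hM0 : 0 ≤ sInf (lowerEnv d f '' simplexS d x v) := Real.sInf_nonneg (by
    rintro _ ⟨z, -, rfl⟩
    exact hf.lowerEnv_nonneg z)
  set M := sInf (lowerEnv d f '' simplexS d x v) with hMdef
  rcases hM0.eq_or_lt with hM | hM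
  · rw [← hM, zero_div, Real.zero_rpow hq0.ne', mul_zero] at hR
    exact Eventually.of_forall fun n => hR.le.trans (by positivity)
  obtain ⟨M', hM'0, hMM', hRM'⟩ :
      ∃ M' : ℚ, (0 : ℝ) < M' ∧ M' < M ∧ R < c / d * ((M' : ℝ) / ∏ i, v i) ^ q := by
    have hcont : ContinuousAt (fun s : ℝ => c / d * (s / ∏ i, v i) ^ q) M :=
      ((continuousAt_id.div_const _).rpow_const (Or.inr hq0.le)).const_mul _
    obtain ⟨t, ht, hsub⟩ := exists_Ioc_subset_of_mem_nhds (hcont.eventually (lt_mem_nhds hR))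
      (exists_lt M)
    obtain ⟨M', h1, h2⟩ := exists_rat_btwn (max_lt ht hM)
    exact ⟨M', (le_max_right _ _).trans_lt h1, h2, hsub ⟨(le_max_left _ _).trans_lt h1, h2.le⟩⟩
  obtain ⟨δ, hδ0, hδ1, hRδ⟩ : ∃ δ > 0, δ < 1 ∧
      R < c / d * ((M' : ℝ) / ∏ i, v i) ^ q * (1 - δ) := by
    have hcont : Continuous fun δ : ℝ =>
      c / d * ((M' : ℝ) / ∏ i, v i) ^ q * (1 - δ) := by fun_prop
    have h := (hcont.tendsto 0).eventually (lt_mem_nhds (a := R) (by simpa using hRM'))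
    obtain ⟨t, ht, hsub⟩ := exists_Ico_subset_of_mem_nhds (h.and (gt_mem_nhds one_pos))
      (exists_gt 0)
    have hmem := hsub (show t / 2 ∈ Ico 0 t from ⟨by linarith, by linarith⟩)
    exact ⟨t / 2, by linarith, hmem.2, hmem.1⟩
  set h : Fin d → ℝ := fun i => 1 / (d * v i) with hh
  have hh0 : ∀ i, 0 < h i := fun i => one_div_pos.2 (mul_pos hd' (hv i))
  have hhv : ∀ i, h i * v i = 1 / d := fun i => by
    have := (hv i).ne'
    rw [hh]; field_simp
  have hδh : ∀ i, 0 < δ * h i := fun i => mul_pos hδ0 (hh0 i)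
  obtain ⟨a, ha⟩ := exists_rat_pi_btwn (s := fun i => x i - h i)
    (t := fun i => x i - h i + δ * h i / 2) fun i => by linarith [hδh i]
  obtain ⟨b, hb⟩ := exists_rat_pi_btwn (s := fun i => x i - δ * h i / 2) (t := x)
    fun i => by linarith [hδh i]
  have hside : ∀ i, (1 - δ) * h i ≤ (b i : ℝ) - a i := fun i => by linarith [(ha i).2, (hb i).1]
  have hside0 : ∀ i, 0 < (1 - δ) * h i := fun i => mul_pos (by linarith) (hh0 i)
  have hab : ∀ i, a i < b i := fun i => by
    have : (a i : ℝ) < b i := by linarith [hside i, hside0 i]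
    exact_mod_cast this
  have hsub : halfOpenBox (fun i => (a i : ℝ)) (fun i => (b i : ℝ)) ⊆ simplexS d x v := by
    intro z hz
    have hz := mem_halfOpenBox.1 hz
    refine ⟨fun i => ((hz i).2.trans (hb i).2).le, ?_⟩
    calc ∑ i, (x i - z i) * v i ≤ ∑ i : Fin d, 1 / (d : ℝ) := Finset.sum_le_sum fun i _ => by
          rw [← hhv i]
          exact mul_le_mul_of_nonneg_right (by linarith [(hz i).1, (ha i).1]) (hv i).le
      _ = 1 := by simp [hd'.ne']
  have hbox := hA.lower a b hab M' (by exact_mod_cast hM'0)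
    (fun z hz => hMM'.le.trans (hle z (hsub hz))) R ?_
  · filter_upwards [hbox] with n hn
    refine hn.trans ?_
    have := chainLength_mono (inter_subset_inter_right (A n) hsub) (hA.finite_simplexS hv n)
    gcongr
  · have hs : ∀ i, 0 ≤ (b i : ℝ) - a i := fun i => (hside0 i).le.trans (hside i)
    rw [rpow_mul_prod_eq hv hM'0.le hs]
    refine hRδ.trans_le ?_
    have hprod : ((1 - δ) / d) ^ d ≤ ∏ i, ((b i : ℝ) - a i) * v i := by
      calc ((1 - δ) / d) ^ d = ∏ _i : Fin d, (1 - δ) / d := by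
            rw [Finset.prod_const, Finset.card_univ, Fintype.card_fin]
        _ ≤ _ := Finset.prod_le_prod (fun i _ => div_nonneg (by linarith) hd'.le) fun i _ => by
          calc (1 - δ) / d = (1 - δ) * h i * v i := by rw [mul_assoc, hhv i]; ring
            _ ≤ _ := mul_le_mul_of_nonneg_right (hside i) (hv i).le
    have hbase : 0 ≤ (1 - δ) / d := div_nonneg (by linarith) hd'.le
    have hroot : (1 - δ) / d ≤ (∏ i, ((b i : ℝ) - a i) * v i) ^ q := by
      have := Real.rpow_le_rpow (pow_nonneg hbase d) hprod hq0.le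
      rw [hq, one_div, Real.pow_rpow_inv_natCast hbase hd.ne', ← one_div] at this
      exact this
    calc _ = c * (((M' : ℝ) / ∏ i, v i) ^ q * ((1 - δ) / d)) := by ring
      _ ≤ _ := by gcongr

end deterministic

/-- With probability one, simultaneously for all `x, v ∈ (0,∞)^d`,
`limsup_n n^{-1/d} ℓ(𝒫_{nf} ∩ S_{x,v}) ≤ (c_d/d) (sup_{S_{x,v}} f* / (v_1⋯v_d))^{1/d}` and
`liminf_n n^{-1/d} ℓ(𝒫_{nf} ∩ S_{x,v}) ≥ (c_d/d) (inf_{S_{x,v}} f_* / (v_1⋯v_d))^{1/d}`. -/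
theorem longest_chain_simplex_bounds_uniform
    {d : ℕ} (hd : 0 < d) (c : ℝ) (hc : IsBWConstant d c)
    (f : (Fin d → ℝ) → ℝ) (hf : MemB d f)
    {Ω : Type*} [MeasurableSpace Ω] (P : Measure Ω) [IsProbabilityMeasure P]
    (PP : ∀ n : ℕ, PoissonPP d P fun z => (n : ℝ) * f z) :
    P {ω | ∀ x v : Fin d → ℝ, (∀ i, 0 < x i) → (∀ i, 0 < v i) →
      limsup (fun n : ℕ => (n : ℝ) ^ (-(1 : ℝ) / d) *
          (chainLength d ((PP n).pts ω ∩ simplexS d x v) : ℝ)) atTop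
        ≤ c / d * (sSup (upperEnv d f '' simplexS d x v) / ∏ i, v i) ^ ((1 : ℝ) / d) ∧
      c / d * (sInf (lowerEnv d f '' simplexS d x v) / ∏ i, v i) ^ ((1 : ℝ) / d)
        ≤ liminf (fun n : ℕ => (n : ℝ) ^ (-(1 : ℝ) / d) *
          (chainLength d ((PP n).pts ω ∩ simplexS d x v) : ℝ)) atTop} = 1 := by
  refine le_antisymm prob_le_one ?_
  rw [← measure_univ (μ := P)]
  refine measure_mono_ae ?_
  filter_upwards [ae_isTypical hd hc hf PP] with ω hω _ x v _ hv
  have hnonneg : ∀ n : ℕ, 0 ≤ (n : ℝ) ^ (-(1 : ℝ) / d) *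
      (chainLength d ((PP n).pts ω ∩ simplexS d x v) : ℝ) := fun n => by positivity
  constructor
  · refine le_of_forall_gt_imp_ge_of_dense fun R hR => ?_
    exact limsup_le_of_le (isBoundedUnder_of_eventually_ge
      (Eventually.of_forall hnonneg)).isCoboundedUnder_le (hω.eventually_le hd hc.1 hf hv hR)
  · obtain ⟨R₀, hR₀⟩ := exists_gt
      (c / d * (sSup (upperEnv d f '' simplexS d x v) / ∏ i, v i) ^ ((1 : ℝ) / d))
    refine le_of_forall_lt_imp_le_of_dense fun R hR => ?_
    exact le_liminf_of_le (isBoundedUnder_of_eventually_le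
      (hω.eventually_le hd hc.1 hf hv hR₀)).isCoboundedUnder_ge
      (hω.eventually_ge hd hc.1 hf hv hR)

end
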